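/- arXiv:1304.7031 — 3 statements merged into one kernel-verified Lean document; each statement's English description precedes it below -/
import Mathlib

section
/- Perturbation of the symplectic spectrum to first order, infinitesimal-time form (Lemma 3.2(ii)): Let m, n ≥ 1 and let M_AB be a real symmetric positive-definite matrix of size 2(m+n). Let S be a symplectic matrix and λ₁,…,λ_{m+n} positive reals with S·M_AB·Sᵀ = D_{m+n}(λ), and let Δ > 0 be such that any two distinct values among λ₁,…,λ_{m+n} differ by at least Δ. Then there exist constants C > 0 and ε₀ > 0 such that for every ε ∈ (0, ε₀) and every value λ occurring among λ₁,…,λ_{m+n}: (a) the number of symplectic eigenvalues (counted with multiplicity) of M_AB + ε·(I_A⊕0_B) lying in the interval [λ − Δ/2, λ + Δ/2] equals the number of indices ℓ with λ_ℓ = λ; and (b) the sum of those symplectic eigenvalues differs from Σ_{ℓ : λ_ℓ = λ} ( λ + (ε/2)·tr([S·(I_A⊕0_B)·Sᵀ]^{(ℓ)}) ) by at most C·ε², where [Z]^{(ℓ)} denotes the 2×2 diagonal block of Z with rows and columns 2ℓ−1 and 2ℓ. -/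
open scoped Classical ComplexOrder

noncomputable section

/-- The function `g(x) = (x+1)·log(x+1) − x·log x` (with `g 0 = 0` since `log 0 = 0`). -/
def gFn (x : ℝ) : ℝ := (x + 1) * Real.log (x + 1) - x * Real.log x

/-- Single-mode entropy as a function of the symplectic eigenvalue: `G(λ) = g((λ−1)/2)`. -/
def GFn (lam : ℝ) : ℝ := gFn ((lam - 1) / 2)

/-- Inverse temperature `β(λ) = log((λ+1)/(λ−1))`. -/
def betaFn (lam : ℝ) : ℝ := Real.log ((lam + 1) / (lam - 1))

/-- The standard symplectic form matrix on `ℝ^d` (for even `d = 2N` this is the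
block-diagonal matrix with `N` diagonal blocks `[[0,1],[-1,0]]`). -/
def Jmat (d : ℕ) : Matrix (Fin d) (Fin d) ℝ := fun i j =>
  if (i : ℕ) % 2 = 0 ∧ (j : ℕ) = (i : ℕ) + 1 then 1
  else if (j : ℕ) % 2 = 0 ∧ (i : ℕ) = (j : ℕ) + 1 then -1 else 0

/-- A real `d×d` matrix is symplectic if `S·J·Sᵀ = J`. -/
def IsSymplectic {d : ℕ} (S : Matrix (Fin d) (Fin d) ℝ) : Prop :=
  S * Jmat d * S.transpose = Jmat d

/-- The doubled diagonal matrix `D(λ) = diag(λ₀,λ₀,λ₁,λ₁,…)`. -/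
def Dmat (d : ℕ) (lam : ℕ → ℝ) : Matrix (Fin d) (Fin d) ℝ :=
  Matrix.diagonal fun i => lam ((i : ℕ) / 2)

/-- A valid quantum covariance matrix: `M` symmetric with `M + i·J ⪰ 0`. -/
def IsQCov {d : ℕ} (M : Matrix (Fin d) (Fin d) ℝ) : Prop :=
  M.IsSymm ∧
    (M.map (Complex.ofReal) + Complex.I • (Jmat d).map Complex.ofReal).PosSemidef

/-- Entropy functional `E(M) = Σⱼ G(λⱼ)` where `λⱼ` are the symplectic eigenvalues of `M`:
the eigenvalues of `i·J·M` are `±λⱼ`, so `E(M) = (1/2)·Σ_{μ root of charpoly} G(|Re μ|)`. -/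
def Ent {d : ℕ} (M : Matrix (Fin d) (Fin d) ℝ) : ℝ :=
  ((Matrix.charpoly (Complex.I • ((Jmat d * M).map Complex.ofReal))).roots.map
    fun μ => GFn |μ.re|).sum / 2

/-- The matrix `I_A ⊕ 0_B`: identity on the first `a` coordinates, zero on the rest. -/
def IA0B (d a : ℕ) : Matrix (Fin d) (Fin d) ℝ :=
  Matrix.diagonal fun i => if (i : ℕ) < a then 1 else 0

/-- Assemble a symmetric 2×2 block matrix `[[A, K], [Kᵀ, B]]`. -/
def assemble2 {a b : ℕ} (A : Matrix (Fin a) (Fin a) ℝ) (K : Matrix (Fin a) (Fin b) ℝ)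
    (B : Matrix (Fin b) (Fin b) ℝ) : Matrix (Fin (a + b)) (Fin (a + b)) ℝ := fun i j =>
  if hi : (i : ℕ) < a then
    if hj : (j : ℕ) < a then A ⟨i, hi⟩ ⟨j, hj⟩
    else K ⟨i, hi⟩ ⟨(j : ℕ) - a, by have := j.isLt; omega⟩
  else
    if hj : (j : ℕ) < a then K ⟨j, hj⟩ ⟨(i : ℕ) - a, by have := i.isLt; omega⟩
    else B ⟨(i : ℕ) - a, by have := i.isLt; omega⟩ ⟨(j : ℕ) - a, by have := j.isLt; omega⟩

/-- Assemble the symmetric 3×3 block matrix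
`[[Y, K₁, K₂], [K₁ᵀ, B₁, 0], [K₂ᵀ, 0, B₂]]`. -/
def assemble3 {a b c : ℕ} (Y : Matrix (Fin a) (Fin a) ℝ)
    (K₁ : Matrix (Fin a) (Fin b) ℝ) (K₂ : Matrix (Fin a) (Fin c) ℝ)
    (B₁ : Matrix (Fin b) (Fin b) ℝ) (B₂ : Matrix (Fin c) (Fin c) ℝ) :
    Matrix (Fin (a + b + c)) (Fin (a + b + c)) ℝ := fun i j =>
  if hi : (i : ℕ) < a then
    if hj : (j : ℕ) < a then Y ⟨i, hi⟩ ⟨j, hj⟩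
    else if hj' : (j : ℕ) < a + b then K₁ ⟨i, hi⟩ ⟨(j : ℕ) - a, by omega⟩
    else K₂ ⟨i, hi⟩ ⟨(j : ℕ) - a - b, by have := j.isLt; omega⟩
  else if hi' : (i : ℕ) < a + b then
    if hj : (j : ℕ) < a then K₁ ⟨j, hj⟩ ⟨(i : ℕ) - a, by omega⟩
    else if hj' : (j : ℕ) < a + b then
      B₁ ⟨(i : ℕ) - a, by omega⟩ ⟨(j : ℕ) - a, by omega⟩
    else 0
  else
    if hj : (j : ℕ) < a then K₂ ⟨j, hj⟩ ⟨(i : ℕ) - a - b, by have := i.isLt; omega⟩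
    else if hj' : (j : ℕ) < a + b then 0
    else B₂ ⟨(i : ℕ) - a - b, by have := i.isLt; omega⟩
      ⟨(j : ℕ) - a - b, by have := j.isLt; omega⟩


open Matrix Polynomial in
lemma exists_aeval_expansion {ι : Type*} [Fintype ι] [DecidableEq ι] (a : ι → ℝ)
    (B C : Matrix ι ι ℝ) (p : ℝ[X]) :
    ∃ (F : Matrix ι ι ℝ) (R : ℝ → Matrix ι ι ℝ), Continuous R ∧
      (∀ i, F i i = p.derivative.eval (a i) * B i i) ∧
      ∀ t : ℝ, aeval (diagonal a + t • B + t ^ 2 • C) p =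
        diagonal (fun i => p.eval (a i)) + t • F + t ^ 2 • R t := by
  induction p using Polynomial.induction_on with
  | C c =>
    refine ⟨0, 0, continuous_const, by simp, fun t => ?_⟩
    simp [aeval_C, Matrix.algebraMap_eq_diagonal, Pi.algebraMap_def]
  | add p q hp hq =>
    obtain ⟨F, R, hR, hF, h⟩ := hp
    obtain ⟨F', R', hR', hF', h'⟩ := hq
    refine ⟨F + F', fun t => R t + R' t, hR.add hR', fun i => ?_, fun t => ?_⟩
    · simp [hF, hF', add_mul]
    · rw [map_add, h, h']
      simp only [eval_add, ← diagonal_add, smul_add]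
      abel
  | monomial n c hp =>
    rw [pow_succ, ← mul_assoc]
    generalize Polynomial.C c * X ^ n = p at hp
    obtain ⟨F, R, hR, hF, h⟩ := hp
    refine ⟨diagonal (fun i => p.eval (a i)) * B + F * diagonal a,
      fun t => diagonal (fun i => p.eval (a i)) * C + F * B + R t * diagonal a +
        t • (F * C + R t * B) + t ^ 2 • (R t * C), ?_, fun i => ?_, fun t => ?_⟩
    · fun_prop
    · simp [hF, diagonal_mul, mul_diagonal]; ring
    · rw [map_mul, h, aeval_X]
      have : diagonal (fun i => (p * X).eval (a i)) =
          diagonal (fun i => p.eval (a i)) * diagonal a := by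
        simp [diagonal_mul_diagonal]
      rw [this]
      simp only [add_mul, mul_add, smul_mul_assoc, mul_smul_comm, smul_add, smul_smul]
      module

open Matrix in
/-- A Gershgorin type bound for the eigenvalues of a perturbed diagonal matrix. -/
lemma exists_abs_sub_le_of_mul_eq_mul_diagonal {ι : Type*} [Fintype ι] [DecidableEq ι]
    (a b : ι → ℝ) (E U : Matrix ι ι ℝ) (hU : IsUnit U)
    (h : (diagonal a + E) * U = U * diagonal b) (j : ι) :
    ∃ i, |b j - a i| ≤ ∑ k, |E i k| := by
  obtain ⟨i, -, hi⟩ := Finset.exists_max_image Finset.univ (fun i => |U i j|) ⟨j, Finset.mem_univ j⟩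
  have hne : 0 < |U i j| := by
    by_contra hcon
    have h0 : ∀ k, U k j = 0 := fun k =>
      abs_eq_zero.1 (le_antisymm ((hi k (Finset.mem_univ k)).trans (not_lt.1 hcon)) (abs_nonneg _))
    have := det_eq_zero_of_column_eq_zero j h0
    exact ((Matrix.isUnit_iff_isUnit_det U).1 hU).ne_zero this
  refine ⟨i, ?_⟩
  have h1 := congrFun (congrFun h i) j
  rw [add_mul, Matrix.add_apply, diagonal_mul, mul_diagonal, Matrix.mul_apply] at h1
  have h2 : (b j - a i) * U i j = ∑ k, E i k * U k j := by linarith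
  have h3 : |b j - a i| * |U i j| ≤ (∑ k, |E i k|) * |U i j| := by
    rw [← abs_mul, h2, Finset.sum_mul]
    refine (Finset.abs_sum_le_sum_abs _ _).trans (Finset.sum_le_sum fun k _ => ?_)
    rw [abs_mul]
    exact mul_le_mul_of_nonneg_left (hi k (Finset.mem_univ k)) (abs_nonneg _)
  exact le_of_mul_le_mul_right h3 hne

open Polynomial in
/-- Hermite interpolation of a value and a derivative at one node, with double zeros at the other
nodes. -/
lemma exists_hermite (s : Finset ℝ) {x₀ : ℝ} (hx₀ : x₀ ∈ s) (α β : ℝ) :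
    ∃ p : ℝ[X], p.eval x₀ = α ∧ p.derivative.eval x₀ = β ∧
      ∀ x ∈ s, x ≠ x₀ → p.eval x = 0 ∧ p.derivative.eval x = 0 := by
  set L := Lagrange.basis s (id : ℝ → ℝ) x₀
  have h1 : L.eval x₀ = 1 := Lagrange.eval_basis_self (v := id) (Set.injOn_id _) hx₀
  have h0 : ∀ x ∈ s, x ≠ x₀ → L.eval x = 0 := fun x hx hne =>
    Lagrange.eval_basis_of_ne (v := id) hne.symm hx
  refine ⟨L ^ 2 * (C α + C (β - α * (2 * L.derivative.eval x₀)) * (X - C x₀)), ?_, ?_, ?_⟩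
  · simp [h1]
  · simp [h1, derivative_pow]; ring
  · intro x hx hne
    simp [h0 x hx hne, derivative_pow]

open Polynomial in
/-- First order Taylor expansion of `x ↦ p (x ^ 2)`. -/
lemma exists_abs_eval_sq_sub_le (p : ℝ[X]) (a : ℝ) :
    ∃ K : ℝ, 0 ≤ K ∧ ∀ x, |x - a| ≤ 1 →
      |p.eval (x ^ 2) - (p.eval (a ^ 2) + 2 * a * p.derivative.eval (a ^ 2) * (x - a))| ≤
        K * (x - a) ^ 2 := by
  set q := p.comp (X ^ 2)
  obtain ⟨g, hg⟩ : X - C a ∣ q - C (q.eval a) := by simp [dvd_iff_isRoot]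
  obtain ⟨r, hr⟩ : X - C a ∣ g - C (g.eval a) := by simp [dvd_iff_isRoot]
  have hga : g.eval a = 2 * a * p.derivative.eval (a ^ 2) := by
    have := congrArg (fun f => (derivative f).eval a) hg
    simp [q, derivative_comp] at this
    linarith
  obtain ⟨K, hK⟩ := (isCompact_closedBall a 1).exists_bound_of_continuousOn
    (f := fun x => r.eval x) r.continuous.continuousOn
  refine ⟨max K 0, le_max_right _ _, fun x hx => ?_⟩
  have e1 := congrArg (eval x) hg
  have e2 := congrArg (eval x) hr
  simp only [eval_sub, eval_mul, eval_X, eval_C, q, eval_comp, eval_pow] at e1 e2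
  have : p.eval (x ^ 2) - (p.eval (a ^ 2) + 2 * a * p.derivative.eval (a ^ 2) * (x - a)) =
      r.eval x * (x - a) ^ 2 := by
    rw [← hga]; linear_combination e1 + (x - a) * e2
  rw [this, abs_mul, abs_of_nonneg (sq_nonneg (x - a))]
  refine mul_le_mul_of_nonneg_right ((hK x ?_).trans (le_max_left _ _)) (sq_nonneg _)
  simpa [Real.dist_eq] using hx

/-- The involution exchanging `2ℓ` and `2ℓ + 1`. -/
def pairSwap {N : ℕ} (i : Fin (2 * N)) : Fin (2 * N) :=
  ⟨if (i : ℕ) % 2 = 0 then i + 1 else i - 1, by have := i.isLt; split_ifs <;> omega⟩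

/-- The sign of the nonzero entry of `Jmat` in row `i`. -/
def pairSign {N : ℕ} (i : Fin (2 * N)) : ℝ := if (i : ℕ) % 2 = 0 then 1 else -1

lemma pairSwap_div {N : ℕ} (i : Fin (2 * N)) : (pairSwap i : ℕ) / 2 = (i : ℕ) / 2 := by
  simp only [pairSwap]; split_ifs <;> omega

lemma pairSwap_pairSwap {N : ℕ} (i : Fin (2 * N)) : pairSwap (pairSwap i) = i := by
  ext; simp only [pairSwap]; split_ifs <;> omega

lemma pairSign_pairSwap {N : ℕ} (i : Fin (2 * N)) : pairSign (pairSwap i) = -pairSign i := by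
  simp only [pairSwap, pairSign]; split_ifs <;> first | omega | simp

lemma pairSign_mul_self {N : ℕ} (i : Fin (2 * N)) : pairSign i * pairSign i = 1 := by
  simp only [pairSign]; split_ifs <;> simp

lemma Jmat_apply {N : ℕ} (i j : Fin (2 * N)) :
    Jmat (2 * N) i j = if j = pairSwap i then pairSign i else 0 := by
  simp only [Jmat, pairSwap, pairSign, Fin.ext_iff]
  split_ifs <;> first | rfl | omega

lemma Jmat_mul_apply {N : ℕ} (A : Matrix (Fin (2 * N)) (Fin (2 * N)) ℝ) (i j : Fin (2 * N)) :
    (Jmat (2 * N) * A) i j = pairSign i * A (pairSwap i) j := by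
  simp [Matrix.mul_apply, Jmat_apply]

lemma mul_Jmat_apply {N : ℕ} (A : Matrix (Fin (2 * N)) (Fin (2 * N)) ℝ) (i j : Fin (2 * N)) :
    (A * Jmat (2 * N)) i j = -pairSign j * A i (pairSwap j) := by
  have : ∀ k, j = pairSwap k ↔ k = pairSwap j := fun k =>
    ⟨fun h => by rw [h, pairSwap_pairSwap], fun h => by rw [h, pairSwap_pairSwap]⟩
  simp [Matrix.mul_apply, Jmat_apply, this, pairSign_pairSwap, mul_comm]

lemma Jmat_mul_Jmat (N : ℕ) : Jmat (2 * N) * Jmat (2 * N) = -1 := by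
  ext i j
  rw [Jmat_mul_apply, Jmat_apply, pairSwap_pairSwap, pairSign_pairSwap, Matrix.neg_apply,
    Matrix.one_apply]
  by_cases h : j = i
  · simp [h, pairSign_mul_self]
  · simp [h, Ne.symm h]

lemma Jmat_mul_Dmat (N : ℕ) (lam : ℕ → ℝ) :
    Jmat (2 * N) * Dmat (2 * N) lam = Dmat (2 * N) lam * Jmat (2 * N) := by
  ext i j
  rw [Dmat, Matrix.mul_diagonal, Matrix.diagonal_mul, Jmat_apply]
  split_ifs with h
  · rw [h, pairSwap_div, mul_comm]
  · simp

lemma sum_fin_two_mul {N : ℕ} (f : Fin (2 * N) → ℝ) :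
    ∑ i, f i = ∑ ℓ : Fin N, (f ⟨2 * ℓ, by have := ℓ.isLt; omega⟩ +
      f ⟨2 * ℓ + 1, by have := ℓ.isLt; omega⟩) := by
  let e : Fin N × Fin 2 ≃ Fin (2 * N) := finProdFinEquiv.trans (finCongr (mul_comm N 2))
  rw [← e.sum_comp, Fintype.sum_prod_type]
  refine Finset.sum_congr rfl fun ℓ _ => ?_
  rw [Fin.sum_univ_two]
  congr 2 <;> ext <;> simp [e, finProdFinEquiv, add_comm]

namespace IsSymplectic

open Matrix

variable {N : ℕ} {T : Matrix (Fin (2 * N)) (Fin (2 * N)) ℝ}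

lemma left_inverse (hT : IsSymplectic T) :
    -(Jmat (2 * N) * Tᵀ * Jmat (2 * N)) * T = 1 := by
  rw [mul_eq_one_comm]
  have h : T * Jmat (2 * N) * Tᵀ = Jmat (2 * N) := hT
  rw [mul_neg, ← mul_assoc, ← mul_assoc, h, Jmat_mul_Jmat, neg_neg]

lemma isUnit (hT : IsSymplectic T) : IsUnit T :=
  IsUnit.of_mul_eq_one_right _ hT.left_inverse

lemma transpose_mul_mul (hT : IsSymplectic T) : Tᵀ * Jmat (2 * N) * T = Jmat (2 * N) := by
  have h := congrArg (Jmat (2 * N) * ·) hT.left_inverse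
  simpa only [neg_mul, mul_neg, ← mul_assoc, Jmat_mul_Jmat, one_mul, neg_neg, mul_one] using h

lemma mul_nonsing_inv {S : Matrix (Fin (2 * N)) (Fin (2 * N)) ℝ} (hT : IsSymplectic T)
    (hS : IsSymplectic S) : IsSymplectic (T * S⁻¹) := by
  have hu : IsUnit S.det := (Matrix.isUnit_iff_isUnit_det S).1 hS.isUnit
  have hu' : IsUnit Sᵀ.det := by rwa [det_transpose]
  have h : S⁻¹ * Jmat (2 * N) * (Sᵀ)⁻¹ = Jmat (2 * N) := by
    conv_lhs => rw [← show S * Jmat (2 * N) * Sᵀ = Jmat (2 * N) from hS]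
    rw [mul_assoc S, nonsing_inv_mul_cancel_left _ _ hu, mul_nonsing_inv_cancel_right _ _ hu']
  have h' : T * Jmat (2 * N) * Tᵀ = Jmat (2 * N) := hT
  unfold IsSymplectic
  rw [transpose_mul, transpose_nonsing_inv]
  calc T * S⁻¹ * Jmat (2 * N) * ((Sᵀ)⁻¹ * Tᵀ)
      = T * (S⁻¹ * Jmat (2 * N) * (Sᵀ)⁻¹) * Tᵀ := by simp only [mul_assoc]
    _ = Jmat (2 * N) := by rw [h, h']

/-- A symplectic diagonalization of `K` diagonalizes `-(J K)²` by similarity. -/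
lemma neg_sq_mul_transpose (hT : IsSymplectic T) {K : Matrix (Fin (2 * N)) (Fin (2 * N)) ℝ}
    {mu : ℕ → ℝ} (h : T * K * Tᵀ = Dmat (2 * N) mu) :
    -(Jmat (2 * N) * K * (Jmat (2 * N) * K)) * Tᵀ =
      Tᵀ * diagonal fun i : Fin (2 * N) => mu ((i : ℕ) / 2) ^ 2 := by
  have h1 : Jmat (2 * N) * K * Tᵀ = Tᵀ * (Jmat (2 * N) * Dmat (2 * N) mu) := by
    rw [← h]
    simp only [← mul_assoc]
    rw [hT.transpose_mul_mul]
  have h2 : Jmat (2 * N) * Dmat (2 * N) mu * (Jmat (2 * N) * Dmat (2 * N) mu) =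
      -diagonal fun i : Fin (2 * N) => mu ((i : ℕ) / 2) ^ 2 := by
    nth_rewrite 1 [Jmat_mul_Dmat]
    rw [mul_assoc, ← mul_assoc (Jmat _) (Jmat _), Jmat_mul_Jmat, neg_one_mul,
      mul_neg, Dmat, diagonal_mul_diagonal]
    simp only [sq]
  rw [neg_mul, mul_assoc, h1, ← mul_assoc, h1, mul_assoc, h2, mul_neg, neg_neg]

end IsSymplectic

section Perturbation

open Matrix Polynomial

variable {N : ℕ} (lam : ℕ → ℝ) (Z : Matrix (Fin (2 * N)) (Fin (2 * N)) ℝ)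

/-- The linear coefficient in `t` of `-(J (D + t Z))²`. -/
def negSqLin : Matrix (Fin (2 * N)) (Fin (2 * N)) ℝ :=
  Dmat (2 * N) lam * Z - Jmat (2 * N) * Z * Jmat (2 * N) * Dmat (2 * N) lam

/-- The quadratic coefficient in `t` of `-(J (D + t Z))²`. -/
def negSqQuad : Matrix (Fin (2 * N)) (Fin (2 * N)) ℝ :=
  -(Jmat (2 * N) * Z * (Jmat (2 * N) * Z))

lemma neg_sq_eq (t : ℝ) :
    -(Jmat (2 * N) * (Dmat (2 * N) lam + t • Z) * (Jmat (2 * N) * (Dmat (2 * N) lam + t • Z))) =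
      (diagonal fun i : Fin (2 * N) => lam ((i : ℕ) / 2) ^ 2) + t • negSqLin lam Z +
        t ^ 2 • negSqQuad Z := by
  have hD : (diagonal fun i : Fin (2 * N) => lam ((i : ℕ) / 2) ^ 2) =
      Dmat (2 * N) lam * Dmat (2 * N) lam := by
    rw [Dmat, diagonal_mul_diagonal]; simp only [sq]
  have h1 : ∀ A : Matrix (Fin (2 * N)) (Fin (2 * N)) ℝ,
      Jmat (2 * N) * Dmat (2 * N) lam * (Jmat (2 * N) * A) = -(Dmat (2 * N) lam * A) := by
    intro A
    rw [Jmat_mul_Dmat, mul_assoc, ← mul_assoc (Jmat _) (Jmat _), Jmat_mul_Jmat, neg_one_mul,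
      mul_neg]
  rw [hD, negSqLin, negSqQuad]
  simp only [mul_add, add_mul, mul_smul_comm, smul_mul_assoc, h1, mul_assoc]
  module

lemma negSqLin_apply_self (i : Fin (2 * N)) :
    negSqLin lam Z i i = lam ((i : ℕ) / 2) * (Z i i + Z (pairSwap i) (pairSwap i)) := by
  rw [negSqLin, Matrix.sub_apply, Dmat, diagonal_mul, mul_diagonal, mul_Jmat_apply, Jmat_mul_apply]
  linear_combination lam ((i : ℕ) / 2) * Z (pairSwap i) (pairSwap i) * pairSign_mul_self i

/-- The trace of the `2 × 2` diagonal block number `ℓ`. -/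
def blockTrace (ℓ : Fin N) : ℝ :=
  Z ⟨2 * ℓ, by have := ℓ.isLt; omega⟩ ⟨2 * ℓ, by have := ℓ.isLt; omega⟩ +
    Z ⟨2 * ℓ + 1, by have := ℓ.isLt; omega⟩ ⟨2 * ℓ + 1, by have := ℓ.isLt; omega⟩

lemma sum_pair (f : ℕ → ℝ) :
    ∑ i : Fin (2 * N), f ((i : ℕ) / 2) = 2 * ∑ ℓ : Fin N, f ℓ := by
  rw [sum_fin_two_mul, Finset.mul_sum]
  refine Finset.sum_congr rfl fun ℓ _ => ?_
  have h1 : 2 * (ℓ : ℕ) / 2 = ℓ := by omega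
  have h2 : (2 * (ℓ : ℕ) + 1) / 2 = ℓ := by omega
  rw [h1, h2]
  ring

lemma sum_mul_negSqLin (f : ℕ → ℝ) :
    ∑ i : Fin (2 * N), f ((i : ℕ) / 2) * negSqLin lam Z i i =
      2 * ∑ ℓ : Fin N, f ℓ * (lam ℓ * blockTrace Z ℓ) := by
  rw [sum_fin_two_mul, Finset.mul_sum]
  refine Finset.sum_congr rfl fun ℓ _ => ?_
  have h1 : 2 * (ℓ : ℕ) / 2 = ℓ := by omega
  have h2 : (2 * (ℓ : ℕ) + 1) / 2 = ℓ := by omega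
  have h3 : (2 * (ℓ : ℕ) + 1) % 2 = 1 := by omega
  simp only [negSqLin_apply_self, h1, h2, blockTrace, pairSwap, h3, Nat.mul_mod_right, if_true,
    one_ne_zero, if_false, Nat.add_sub_cancel]
  ring

/-- The trace of a polynomial in a diagonalizable matrix. -/
lemma trace_aeval_eq_sum {ι : Type*} [Fintype ι] [DecidableEq ι] {Q U : Matrix ι ι ℝ} {b : ι → ℝ}
    (hU : IsUnit U) (h : Q * U = U * diagonal b) (p : ℝ[X]) :
    (aeval Q p).trace = ∑ i, p.eval (b i) := by
  have key : aeval Q p * U = U * diagonal fun i => p.eval (b i) := by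
    induction p using Polynomial.induction_on with
    | C c =>
      have : (diagonal fun _ : ι => c) = c • (1 : Matrix ι ι ℝ) := by
        rw [smul_one_eq_diagonal]
      simp [Algebra.algebraMap_eq_smul_one, this]
    | add p q hp hq =>
      simp only [map_add, add_mul, hp, hq, eval_add, ← diagonal_add, mul_add]
    | monomial n c hp =>
      rw [pow_succ, ← mul_assoc, map_mul, aeval_X, mul_assoc, h, ← mul_assoc, hp, mul_assoc,
        diagonal_mul_diagonal]
      simp
  obtain ⟨u, rfl⟩ := hU
  have h' : aeval Q p = u * (diagonal fun i => p.eval (b i)) * (↑u⁻¹ : Matrix ι ι ℝ) := by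
    rw [← key, mul_assoc, Units.mul_inv, mul_one]
  rw [h', trace_mul_cycle, Units.inv_mul, one_mul, trace_diagonal]

/-- First order expansion of `∑ p(μ²)` over the symplectic eigenvalues `μ` of `D + t Z`. -/
lemma exists_sum_eval_sq_bound (p : ℝ[X]) :
    ∃ K : ℝ, 0 ≤ K ∧ ∀ t : ℝ, 0 < t → t < 1 → ∀ (T : Matrix (Fin (2 * N)) (Fin (2 * N)) ℝ)
      (mu : ℕ → ℝ), IsSymplectic T → T * (Dmat (2 * N) lam + t • Z) * Tᵀ = Dmat (2 * N) mu →
      |∑ ℓ : Fin N, p.eval (mu ℓ ^ 2) - ∑ ℓ : Fin N, (p.eval (lam ℓ ^ 2) +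
        t * (p.derivative.eval (lam ℓ ^ 2) * (lam ℓ * blockTrace Z ℓ)))| ≤ K * t ^ 2 := by
  obtain ⟨F, R, hR, hF, hp⟩ := exists_aeval_expansion
    (fun i : Fin (2 * N) => lam ((i : ℕ) / 2) ^ 2) (negSqLin lam Z) (negSqQuad Z) p
  obtain ⟨K, hK⟩ := (isCompact_Icc (a := (0 : ℝ)) (b := 1)).exists_bound_of_continuousOn
    (f := fun t => (R t).trace / 2) (by fun_prop)
  refine ⟨max K 0, le_max_right _ _, fun t ht0 ht1 T mu hT h => ?_⟩
  have hsim := hT.neg_sq_mul_transpose h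
  rw [neg_sq_eq] at hsim
  have htr : (aeval ((diagonal fun i : Fin (2 * N) => lam ((i : ℕ) / 2) ^ 2) +
      t • negSqLin lam Z + t ^ 2 • negSqQuad Z) p).trace =
      2 * ∑ ℓ : Fin N, p.eval (mu ℓ ^ 2) := by
    rw [trace_aeval_eq_sum ((Matrix.isUnit_transpose T).2 hT.isUnit) hsim,
      sum_pair (fun k => p.eval (mu k ^ 2))]
  rw [hp, trace_add, trace_add, trace_smul, trace_smul, trace_diagonal,
    sum_pair (fun k => p.eval (lam k ^ 2))] at htr
  have hFt : F.trace = 2 * ∑ ℓ : Fin N,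
      p.derivative.eval (lam ℓ ^ 2) * (lam ℓ * blockTrace Z ℓ) := by
    rw [← sum_mul_negSqLin lam Z (fun k => p.derivative.eval (lam k ^ 2))]
    exact Finset.sum_congr rfl fun i _ => hF i
  rw [hFt] at htr
  rw [Finset.sum_add_distrib, ← Finset.mul_sum]
  simp only [smul_eq_mul] at htr
  rw [show ∑ ℓ : Fin N, p.eval (mu ℓ ^ 2) - (∑ ℓ : Fin N, p.eval (lam ℓ ^ 2) +
      t * ∑ ℓ : Fin N, p.derivative.eval (lam ℓ ^ 2) * (lam ℓ * blockTrace Z ℓ)) =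
      (R t).trace / 2 * t ^ 2 by linarith, abs_mul, abs_of_nonneg (sq_nonneg t)]
  exact mul_le_mul_of_nonneg_right ((hK t ⟨ht0.le, ht1.le⟩).trans (le_max_left _ _)) (sq_nonneg t)

/-- Symplectic eigenvalues of `D + t Z` are within `O(t)` of those of `D`. -/
lemma exists_abs_sub_le_mul (hpos : ∀ ℓ < N, 0 < lam ℓ) :
    ∃ c : ℝ, 0 ≤ c ∧ ∀ t : ℝ, 0 < t → t < 1 → ∀ (T : Matrix (Fin (2 * N)) (Fin (2 * N)) ℝ)
      (mu : ℕ → ℝ), IsSymplectic T → T * (Dmat (2 * N) lam + t • Z) * Tᵀ = Dmat (2 * N) mu →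
      (∀ ℓ < N, 0 < mu ℓ) → ∀ ℓ : Fin N, ∃ k : Fin N, |mu ℓ - lam k| ≤ c * t := by
  set b : ℝ := ∑ i, ∑ j, (|negSqLin lam Z i j| + |negSqQuad Z i j|) with hb
  have hb0 : 0 ≤ b := by positivity
  have hinv : ∀ k ∈ Finset.univ, 0 ≤ (lam (k : Fin N))⁻¹ := fun k _ =>
    inv_nonneg.2 (hpos k k.isLt).le
  refine ⟨b * ∑ k : Fin N, (lam k)⁻¹, mul_nonneg hb0 (Finset.sum_nonneg hinv),
    fun t ht0 ht1 T mu hT h hmu ℓ => ?_⟩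
  have hsim := hT.neg_sq_mul_transpose h
  rw [neg_sq_eq, add_assoc] at hsim
  obtain ⟨i, hi⟩ := exists_abs_sub_le_of_mul_eq_mul_diagonal _ _ _ _
    ((Matrix.isUnit_transpose T).2 hT.isUnit) hsim ⟨2 * ℓ, by have := ℓ.isLt; omega⟩
  have hℓ : 2 * (ℓ : ℕ) / 2 = ℓ := by omega
  have hk : (i : ℕ) / 2 < N := by have := i.isLt; omega
  simp only [hℓ] at hi
  have hE : ∑ j, |(t • negSqLin lam Z + t ^ 2 • negSqQuad Z) i j| ≤ b * t := by
    calc ∑ j, |(t • negSqLin lam Z + t ^ 2 • negSqQuad Z) i j|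
        ≤ ∑ j, (|negSqLin lam Z i j| + |negSqQuad Z i j|) * t := by
          refine Finset.sum_le_sum fun j _ => (abs_add_le _ _).trans ?_
          have hq : t ^ 2 ≤ t := by nlinarith
          have h0 := mul_le_mul_of_nonneg_right hq (abs_nonneg (negSqQuad Z i j))
          simp only [Matrix.smul_apply, smul_eq_mul, abs_mul, abs_of_pos ht0,
            abs_of_nonneg (sq_nonneg t)]
          linarith
      _ ≤ b * t := by
          rw [← Finset.sum_mul]
          refine mul_le_mul_of_nonneg_right ?_ ht0.le
          exact Finset.single_le_sum
            (f := fun i => ∑ j, (|negSqLin lam Z i j| + |negSqQuad Z i j|))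
            (fun i _ => by positivity) (Finset.mem_univ i)
  refine ⟨⟨(i : ℕ) / 2, hk⟩, ?_⟩
  have hl := hpos _ hk
  have hm := hmu ℓ ℓ.isLt
  have h1 : |mu ℓ - lam ((i : ℕ) / 2)| * lam ((i : ℕ) / 2) ≤ b * t := by
    refine le_trans ?_ (hi.trans hE)
    rw [sq_sub_sq, abs_mul, mul_comm, abs_of_pos (add_pos hm hl)]
    exact mul_le_mul_of_nonneg_right (by linarith) (abs_nonneg _)
  calc |mu ℓ - lam ((i : ℕ) / 2)| ≤ b * t * (lam ((i : ℕ) / 2))⁻¹ := by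
        rwa [← div_eq_mul_inv, le_div_iff₀ hl]
    _ ≤ b * t * ∑ k : Fin N, (lam k)⁻¹ :=
        mul_le_mul_of_nonneg_left (Finset.single_le_sum (f := fun k : Fin N => (lam k)⁻¹) hinv
          (Finset.mem_univ ⟨(i : ℕ) / 2, hk⟩)) (mul_nonneg hb0 ht0.le)
    _ = b * (∑ k : Fin N, (lam k)⁻¹) * t := by ring

/-- The indices `ℓ` with `mu ℓ` within `Δ / 2` of `x`. -/
def cluster (N : ℕ) (mu : ℕ → ℝ) (Δ x : ℝ) : Finset (Fin N) :=
  Finset.univ.filter fun ℓ : Fin N => x - Δ / 2 ≤ mu ℓ ∧ mu ℓ ≤ x + Δ / 2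

/-- Expansion of an affine function summed over a cluster of symplectic eigenvalues. -/
lemma exists_cluster_bound (hpos : ∀ ℓ < N, 0 < lam ℓ) {Δ : ℝ} (hΔ : 0 < Δ)
    (hgap : ∀ i < N, ∀ j < N, lam i ≠ lam j → Δ ≤ |lam i - lam j|) (i : Fin N) (α β : ℝ) :
    ∃ C : ℝ, 0 ≤ C ∧ ∃ t₀ > (0 : ℝ), ∀ t : ℝ, 0 < t → t < t₀ →
      ∀ (T : Matrix (Fin (2 * N)) (Fin (2 * N)) ℝ) (mu : ℕ → ℝ), IsSymplectic T →
      T * (Dmat (2 * N) lam + t • Z) * Tᵀ = Dmat (2 * N) mu → (∀ ℓ < N, 0 < mu ℓ) →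
      |∑ ℓ ∈ cluster N mu Δ (lam i), (α + β * (mu ℓ - lam i)) -
        ∑ ℓ ∈ Finset.univ.filter (fun ℓ : Fin N => lam ℓ = lam i),
          (α + t * (β / 2 * blockTrace Z ℓ))| ≤ C * t ^ 2 := by
  have hli := hpos i i.isLt
  obtain ⟨p, hp, hp', hp0⟩ := exists_hermite (Finset.univ.image fun k : Fin N => lam k ^ 2)
    (x₀ := lam i ^ 2) (by simp) α (β / (2 * lam i))
  have hp0 : ∀ k : Fin N, lam k ≠ lam i →
      p.eval (lam k ^ 2) = 0 ∧ p.derivative.eval (lam k ^ 2) = 0 := fun k hk =>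
    hp0 _ (by simp) fun h => hk ((pow_left_inj₀ (hpos k k.isLt).le hli.le two_ne_zero).1 h)
  obtain ⟨K, hK0, hK⟩ := exists_sum_eval_sq_bound lam Z p
  obtain ⟨c, hc0, hc⟩ := exists_abs_sub_le_mul lam Z hpos
  choose L hL0 hL using fun k : Fin N => exists_abs_eval_sq_sub_le p (lam k)
  have hLs0 : 0 ≤ ∑ k, L k := Finset.sum_nonneg fun k _ => hL0 k
  refine ⟨N * ((∑ k, L k) * c ^ 2) + K, by positivity, min 1 (min (1 / (c + 1)) (Δ / 2 / (c + 1))),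
    by positivity, fun t ht0 ht T mu hT h hmu => ?_⟩
  obtain ⟨ht1, ht2, ht3⟩ : t < 1 ∧ t < 1 / (c + 1) ∧ t < Δ / 2 / (c + 1) := by simpa using ht
  rw [lt_div_iff₀ (by positivity)] at ht2 ht3
  have hsum := hK t ht0 ht1 T mu hT h
  have hterm : ∀ ℓ : Fin N, |p.eval (mu ℓ ^ 2) -
      if ℓ ∈ cluster N mu Δ (lam i) then α + β * (mu ℓ - lam i) else 0| ≤
        (∑ k, L k) * c ^ 2 * t ^ 2 := by
    intro ℓ
    obtain ⟨k, hk⟩ := hc t ht0 ht1 T mu hT h hmu ℓ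
    have hmem : ℓ ∈ cluster N mu Δ (lam i) ↔ lam k = lam i := by
      rw [cluster, Finset.mem_filter]
      have hk' := abs_le.1 hk
      constructor
      · rintro ⟨-, h1, h2⟩
        by_contra hne
        rcases le_abs.1 (hgap k k.isLt i i.isLt hne) with h3 | h3 <;> nlinarith
      · intro he
        rw [he] at hk'
        refine ⟨Finset.mem_univ _, ?_, ?_⟩ <;> nlinarith
    have hval : (if ℓ ∈ cluster N mu Δ (lam i) then α + β * (mu ℓ - lam i) else 0) =
        p.eval (lam k ^ 2) + 2 * lam k * p.derivative.eval (lam k ^ 2) * (mu ℓ - lam k) := by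
      by_cases he : lam k = lam i
      · rw [if_pos (hmem.2 he), he, hp, hp', mul_div_cancel₀ _ (by positivity)]
      · rw [if_neg (mt hmem.1 he), (hp0 k he).1, (hp0 k he).2]; ring
    rw [hval]
    refine (hL k (mu ℓ) (by nlinarith)).trans ?_
    rw [mul_assoc, ← mul_pow, ← sq_abs (mu ℓ - lam k)]
    exact mul_le_mul (Finset.single_le_sum (fun k _ => hL0 k) (Finset.mem_univ k))
      (pow_le_pow_left₀ (abs_nonneg _) hk 2) (sq_nonneg _) hLs0
  have hleft : |∑ ℓ : Fin N, p.eval (mu ℓ ^ 2) -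
      ∑ ℓ ∈ cluster N mu Δ (lam i), (α + β * (mu ℓ - lam i))| ≤
        N * ((∑ k, L k) * c ^ 2) * t ^ 2 := by
    rw [← Finset.sum_ite_mem_eq (cluster N mu Δ (lam i)), ← Finset.sum_sub_distrib]
    refine (Finset.abs_sum_le_sum_abs _ _).trans
      ((Finset.sum_le_sum fun ℓ _ => hterm ℓ).trans_eq ?_)
    simp [mul_assoc]
  have hright : ∑ ℓ : Fin N, (p.eval (lam ℓ ^ 2) +
      t * (p.derivative.eval (lam ℓ ^ 2) * (lam ℓ * blockTrace Z ℓ))) =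
      ∑ ℓ ∈ Finset.univ.filter (fun ℓ : Fin N => lam ℓ = lam i),
        (α + t * (β / 2 * blockTrace Z ℓ)) := by
    rw [Finset.sum_filter]
    refine Finset.sum_congr rfl fun ℓ _ => ?_
    split_ifs with he
    · rw [he, hp, hp']; field_simp
    · rw [(hp0 ℓ he).1, (hp0 ℓ he).2]; ring
  rw [hright] at hsum
  rw [abs_le] at hleft hsum ⊢
  constructor <;> linarith [hleft.1, hleft.2, hsum.1, hsum.2]

/-- First order perturbation of one cluster of symplectic eigenvalues. -/
lemma exists_cluster_perturbation (hpos : ∀ ℓ < N, 0 < lam ℓ) {Δ : ℝ} (hΔ : 0 < Δ)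
    (hgap : ∀ i < N, ∀ j < N, lam i ≠ lam j → Δ ≤ |lam i - lam j|) (i : Fin N) :
    ∃ C > (0 : ℝ), ∃ t₀ > (0 : ℝ), ∀ t : ℝ, 0 < t → t < t₀ →
      ∀ (T : Matrix (Fin (2 * N)) (Fin (2 * N)) ℝ) (mu : ℕ → ℝ), IsSymplectic T →
      T * (Dmat (2 * N) lam + t • Z) * Tᵀ = Dmat (2 * N) mu → (∀ ℓ < N, 0 < mu ℓ) →
      (cluster N mu Δ (lam i)).card =
        (Finset.univ.filter fun ℓ : Fin N => lam ℓ = lam i).card ∧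
      |∑ ℓ ∈ cluster N mu Δ (lam i), mu ℓ -
        ∑ ℓ ∈ Finset.univ.filter (fun ℓ : Fin N => lam ℓ = lam i),
          (lam i + t / 2 * blockTrace Z ℓ)| ≤ C * t ^ 2 := by
  obtain ⟨C₁, hC₁, t₁, ht₁, h₁⟩ := exists_cluster_bound lam Z hpos hΔ hgap i 1 0
  obtain ⟨C₂, hC₂, t₂, ht₂, h₂⟩ := exists_cluster_bound lam Z hpos hΔ hgap i (lam i) 1
  refine ⟨C₂ + 1, by positivity, min (min 1 (1 / (C₁ + 1))) (min t₁ t₂), by positivity,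
    fun t ht0 ht T mu hT h hmu => ⟨?_, ?_⟩⟩
  · obtain ⟨⟨ht1, htC⟩, ht1', -⟩ : (t < 1 ∧ t < 1 / (C₁ + 1)) ∧ t < t₁ ∧ t < t₂ := by
      simpa using ht
    have hb := h₁ t ht0 ht1' T mu hT h hmu
    rw [lt_div_iff₀ (by positivity)] at htC
    simp only [zero_mul, zero_div, mul_zero, add_zero, Finset.sum_const, nsmul_eq_mul,
      mul_one] at hb
    have hlt : |((cluster N mu Δ (lam i)).card : ℝ) -
        (Finset.univ.filter fun ℓ : Fin N => lam ℓ = lam i).card| < 1 := by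
      refine hb.trans_lt ?_
      nlinarith [mul_nonneg hC₁ ht0.le]
    have hz : |((cluster N mu Δ (lam i)).card : ℤ) -
        (Finset.univ.filter fun ℓ : Fin N => lam ℓ = lam i).card| < 1 := by exact_mod_cast hlt
    rw [Int.abs_lt_one_iff] at hz
    omega
  · have hb := h₂ t ht0 (ht.trans_le ((min_le_right _ _).trans (min_le_right _ _))) T mu hT h hmu
    simp only [one_mul, add_sub_cancel] at hb
    have he : ∀ ℓ : Fin N, t / 2 * blockTrace Z ℓ = t * (1 / 2 * blockTrace Z ℓ) :=
      fun ℓ => by ring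
    simp only [he]
    exact hb.trans (by nlinarith [sq_nonneg t])

end Perturbation

/-- Perturbation of the symplectic spectrum to first order,
infinitesimal-time form (Lemma 3.2(ii)). -/
theorem symplectic_perturbation_first_order_infinitesimal (m n : ℕ) (hm : 1 ≤ m) (hn : 1 ≤ n)
    (M : Matrix (Fin (2 * (m + n))) (Fin (2 * (m + n))) ℝ)
    (hsymm : M.IsSymm) (hpd : M.PosDef)
    (S : Matrix (Fin (2 * (m + n))) (Fin (2 * (m + n))) ℝ) (hS : IsSymplectic S)
    (lam : ℕ → ℝ) (hpos : ∀ ℓ < m + n, 0 < lam ℓ)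
    (hdiag : S * M * S.transpose = Dmat (2 * (m + n)) lam)
    (Δ : ℝ) (hΔ : 0 < Δ)
    (hgap : ∀ i < m + n, ∀ j < m + n, lam i ≠ lam j → Δ ≤ |lam i - lam j|) :
    ∃ C > (0 : ℝ), ∃ eps₀ > (0 : ℝ), ∀ eps : ℝ, 0 < eps → eps < eps₀ →
      ∀ i : Fin (m + n),
      ∀ (S' : Matrix (Fin (2 * (m + n))) (Fin (2 * (m + n))) ℝ) (lamv : ℕ → ℝ),
        IsSymplectic S' →
        S' * (M + eps • IA0B (2 * (m + n)) (2 * m)) * S'.transpose =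
          Dmat (2 * (m + n)) lamv →
        ((Finset.univ.filter fun ℓ : Fin (m + n) =>
            lam i - Δ / 2 ≤ lamv ℓ ∧ lamv ℓ ≤ lam i + Δ / 2).card =
          (Finset.univ.filter fun ℓ : Fin (m + n) => lam ℓ = lam i).card) ∧
        |(∑ ℓ ∈ Finset.univ.filter (fun ℓ : Fin (m + n) =>
              lam i - Δ / 2 ≤ lamv ℓ ∧ lamv ℓ ≤ lam i + Δ / 2), lamv ℓ) -
          ∑ ℓ ∈ Finset.univ.filter (fun ℓ : Fin (m + n) => lam ℓ = lam i),
            (lam i + eps / 2 *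
              ((S * IA0B (2 * (m + n)) (2 * m) * S.transpose)
                  ⟨2 * ℓ, by have := ℓ.isLt; omega⟩ ⟨2 * ℓ, by have := ℓ.isLt; omega⟩ +
               (S * IA0B (2 * (m + n)) (2 * m) * S.transpose)
                  ⟨2 * ℓ + 1, by have := ℓ.isLt; omega⟩
                  ⟨2 * ℓ + 1, by have := ℓ.isLt; omega⟩))| ≤ C * eps ^ 2 := by
  have hu : IsUnit S.det := (Matrix.isUnit_iff_isUnit_det S).1 hS.isUnit
  choose C hC t₀ ht₀ h using fun i : Fin (m + n) =>
    exists_cluster_perturbation lam (S * IA0B (2 * (m + n)) (2 * m) * S.transpose) hpos hΔ hgap i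
  have : Nonempty (Fin (m + n)) := ⟨⟨0, by omega⟩⟩
  obtain ⟨j, hj⟩ := Finite.exists_min t₀
  refine ⟨∑ i, C i, Finset.sum_pos (fun i _ => hC i) Finset.univ_nonempty, t₀ j, ht₀ j,
    fun eps h0 hlt i S' lamv hS' hd => ?_⟩
  have hP : (IA0B (2 * (m + n)) (2 * m)).PosSemidef :=
    Matrix.PosSemidef.diagonal fun i => by dsimp only; split_ifs <;> simp
  have hK : (M + eps • IA0B (2 * (m + n)) (2 * m)).PosDef :=
    hpd.add_posSemidef (hP.smul h0.le)
  have hD' : (Dmat (2 * (m + n)) lamv).PosDef := by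
    rw [← hd, ← Matrix.conjTranspose_eq_transpose_of_trivial]
    exact hK.mul_mul_conjTranspose_same (Matrix.vecMul_injective_of_isUnit hS'.isUnit)
  have hmu : ∀ ℓ < m + n, 0 < lamv ℓ := fun ℓ hℓ => by
    have h1 := hD'.diag_pos (i := ⟨2 * ℓ, by omega⟩)
    rw [Dmat, Matrix.diagonal_apply_eq] at h1
    simpa using h1
  have hcancel : S' * S⁻¹ * S = S' := Matrix.nonsing_inv_mul_cancel_right _ _ hu
  have hconj : S' * S⁻¹ * (Dmat (2 * (m + n)) lam +
      eps • (S * IA0B (2 * (m + n)) (2 * m) * S.transpose)) * (S' * S⁻¹).transpose =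
      Dmat (2 * (m + n)) lamv := by
    have hcancel' : S.transpose * (S' * S⁻¹).transpose = S'.transpose := by
      rw [← Matrix.transpose_mul, hcancel]
    calc _ = S' * S⁻¹ * S * (M + eps • IA0B (2 * (m + n)) (2 * m)) *
          (S.transpose * (S' * S⁻¹).transpose) := by
          rw [← hdiag]
          simp only [mul_add, add_mul, mul_smul_comm, smul_mul_assoc, mul_assoc]
      _ = Dmat (2 * (m + n)) lamv := by rw [hcancel, hcancel', hd]
  obtain ⟨hcard, hsum⟩ := h i eps h0 (hlt.trans_le (hj i)) _ lamv (hS'.mul_nonsing_inv hS) hconj hmu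
  refine ⟨hcard, hsum.trans (mul_le_mul_of_nonneg_right ?_ (sq_nonneg eps))⟩
  exact Finset.single_le_sum (fun i _ => (hC i).le) (Finset.mem_univ i)

end
end

section
/- Scaling of conditional entropy in the infinite-time limit under diffusion (Lemma 4.4): Let m, n ≥ 1 and let M_AB be a valid quantum covariance matrix of size 2(m+n) with B-block M_B. Then lim_{t→∞} ( E(M_AB + t·(I_A⊕0_B)) − E(M_B) − m·g((t−1)/2) ) = 0. -/
open scoped Classical ComplexOrder

noncomputable section

open Polynomial in
lemma exists_norm_le_of_tendsto_prod_sub {ι : Type*} [Fintype ι] (z : ℕ → ι → ℂ) (q : ℂ[X])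
    (h : ∀ x : ℂ, Filter.Tendsto (fun k => ∏ i, (x - z k i)) Filter.atTop (nhds (q.eval x))) :
    ∃ R : ℝ, ∀ k i, ‖z k i‖ ≤ R := by
  let P : ℕ → ℂ[X] := fun k => ∏ i, (X - C (z k i))
  have hPm : ∀ k, (P k).Monic := fun k => monic_prod_of_monic _ _ fun i _ => monic_X_sub_C _
  have hPd : ∀ k, (P k).natDegree = Fintype.card ι := fun k => by
    simp [P, natDegree_prod_of_monic _ (fun i => X - C (z k i)) fun i _ => monic_X_sub_C _]
  have hPe : ∀ k x, (P k).eval x = ∏ i, (x - z k i) := fun k x => by simp [P, eval_prod]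
  let s := Finset.range (Fintype.card ι + 1)
  let v : ℕ → ℂ := fun i => i
  have hv : Set.InjOn v s := fun i _ j _ hij => by simpa [v] using hij
  have hcoeff : ∀ j, ∃ a, Filter.Tendsto (fun k => (P k).coeff j) Filter.atTop (nhds a) := by
    intro j
    refine ⟨∑ i ∈ s, q.eval (v i) * (Lagrange.basis s v i).coeff j, ?_⟩
    have : ∀ k, (P k).coeff j = ∑ i ∈ s, (P k).eval (v i) * (Lagrange.basis s v i).coeff j := by
      intro k
      have hlt : (P k).degree < s.card := by
        rw [degree_eq_natDegree (hPm k).ne_zero, hPd]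
        simp only [s, Finset.card_range]
        exact_mod_cast Nat.lt_succ_self _
      conv_lhs => rw [Lagrange.eq_interpolate hv hlt]
      simp [Lagrange.interpolate_apply, finsetSum_coeff]
    simp_rw [this, hPe]
    exact tendsto_finsetSum _ fun i _ => (h (v i)).mul_const _
  have hbd : ∀ j, ∃ R : NNReal, ∀ k, ‖(P k).coeff j‖₊ ≤ R := by
    intro j
    obtain ⟨a, ha⟩ := hcoeff j
    obtain ⟨R, hR⟩ := (Metric.isBounded_range_of_tendsto _ ha).exists_norm_le
    exact ⟨R.toNNReal, fun k => NNReal.le_toNNReal_of_coe_le (hR _ ⟨k, rfl⟩)⟩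
  choose R hR using hbd
  refine ⟨((Finset.range (Fintype.card ι)).sup R + 1 : NNReal), fun k i => ?_⟩
  have hroot : (P k).IsRoot (z k i) := by
    rw [IsRoot, hPe]
    exact Finset.prod_eq_zero (Finset.mem_univ i) (sub_self _)
  have hlt := hroot.norm_lt_cauchyBound (hPm k).ne_zero
  have hle : cauchyBound (P k) ≤ (Finset.range (Fintype.card ι)).sup R + 1 := by
    rw [cauchyBound, (hPm k).leadingCoeff, hPd]
    simp only [nnnorm_one, div_one]
    gcongr
    exact hR _ k
  exact hlt.le.trans (NNReal.coe_le_coe.mpr hle)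

open Polynomial in
lemma exists_subseq_tendsto_of_tendsto_prod_sub {ι : Type*} [Fintype ι] (z : ℕ → ι → ℂ)
    (q : ℂ[X])
    (h : ∀ x : ℂ, Filter.Tendsto (fun k => ∏ i, (x - z k i)) Filter.atTop (nhds (q.eval x))) :
    ∃ (w : ι → ℂ) (φ : ℕ → ℕ), StrictMono φ ∧ Filter.Tendsto (z ∘ φ) Filter.atTop (nhds w) ∧
      ∏ i, (X - C (w i)) = q := by
  obtain ⟨R, hR⟩ := exists_norm_le_of_tendsto_prod_sub z q h
  have hb : Bornology.IsBounded (Set.range z) := by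
    rw [isBounded_iff_forall_norm_le]
    refine ⟨max R 0, ?_⟩
    rintro _ ⟨k, rfl⟩
    exact (pi_norm_le_iff_of_nonneg (le_max_right _ _)).2 fun i => (hR k i).trans (le_max_left _ _)
  obtain ⟨w, -, φ, hφ, hw⟩ := tendsto_subseq_of_bounded hb fun k => Set.mem_range_self k
  refine ⟨w, φ, hφ, hw, Polynomial.funext fun x => ?_⟩
  have h1 := (h x).comp hφ.tendsto_atTop
  have h2 : Filter.Tendsto (fun k => ∏ i, (x - z (φ k) i)) Filter.atTop
      (nhds (∏ i, (x - w i))) :=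
    tendsto_finsetProd _ fun i _ => tendsto_const_nhds.sub ((tendsto_pi_nhds.1 hw) i)
  simpa [eval_prod] using tendsto_nhds_unique h2 h1

lemma GFn_continuous : Continuous GFn := by
  have h : Continuous gFn := by
    unfold gFn
    exact (Real.continuous_mul_log.comp (continuous_id.add continuous_const)).sub
      Real.continuous_mul_log
  exact h.comp (by fun_prop)

lemma tendsto_GFn_sub_log :
    Filter.Tendsto (fun x => GFn x - Real.log x) Filter.atTop (nhds (1 + Real.log (1 / 2))) := by
  have h1 : Filter.Tendsto (fun x : ℝ => (x - 1) / 2) Filter.atTop Filter.atTop :=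
    (Filter.tendsto_atTop_add_const_right _ (-1) Filter.tendsto_id).atTop_div_const (by norm_num)
  have h2 := (Real.tendsto_mul_log_one_add_div_atTop 1).comp h1
  have h3 : Filter.Tendsto (fun x : ℝ => 1 / 2 + (1 / 2) * x⁻¹) Filter.atTop (nhds (1 / 2)) := by
    have h := ((tendsto_inv_atTop_zero (𝕜 := ℝ)).const_mul (1 / 2)).const_add (1 / 2)
    rwa [mul_zero, add_zero] at h
  have h4 := h3.log (by norm_num)
  refine (h2.add h4).congr' ?_
  filter_upwards [Filter.eventually_gt_atTop 1] with x hx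
  have hx0 : 0 < x := by linarith
  have hy : 0 < (x - 1) / 2 := by linarith
  have e1 : 1 + 1 / ((x - 1) / 2) = ((x - 1) / 2 + 1) / ((x - 1) / 2) := by
    field_simp
  have e2 : 1 / 2 + 1 / 2 * x⁻¹ = ((x - 1) / 2 + 1) / x := by
    field_simp; ring
  simp only [Function.comp, GFn, gFn]
  have hy' : (x - 1) / 2 + 1 ≠ 0 := by positivity
  rw [e1, e2, Real.log_div hy' hy.ne', Real.log_div hy' hx0.ne']
  ring

lemma tendsto_GFn_sub_GFn {r t : ℕ → ℝ} (ht : Filter.Tendsto t Filter.atTop Filter.atTop)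
    (hr : Filter.Tendsto (fun k => r k / t k) Filter.atTop (nhds 1)) :
    Filter.Tendsto (fun k => GFn (r k) - GFn (t k)) Filter.atTop (nhds 0) := by
  have ht0 := ht.eventually_gt_atTop 0
  have hrt : Filter.Tendsto r Filter.atTop Filter.atTop := by
    refine (ht.atTop_mul_pos one_pos hr).congr' ?_
    filter_upwards [ht0] with k hk
    field_simp
  have h := ((tendsto_GFn_sub_log.comp hrt).sub (tendsto_GFn_sub_log.comp ht)).add
    (hr.log one_ne_zero)
  simp only [sub_self, Real.log_one, add_zero] at h
  refine h.congr' ?_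
  filter_upwards [ht0, hrt.eventually_gt_atTop 0] with k hk hk'
  simp only [Function.comp]
  rw [Real.log_div hk'.ne' hk.ne']
  ring

open Polynomial in
lemma exists_roots_eq_map {N : ℕ} {p : ℂ[X]} (hp : p.Monic) (hd : p.natDegree = N) :
    ∃ z : Fin N → ℂ, p.roots = Finset.univ.val.map z ∧ p = ∏ i, (X - C (z i)) := by
  have hs := IsAlgClosed.splits p
  have hc : p.roots.card = N := by rw [← hs.natDegree_eq_card_roots, hd]
  obtain ⟨z, hz⟩ : ∃ z : Fin N → ℂ, p.roots = Finset.univ.val.map z := by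
    subst hc
    refine ⟨fun i => p.roots.toList.get (i.cast (by simp)), ?_⟩
    conv_lhs => rw [← Multiset.coe_toList p.roots]
    simp only [Fin.univ_val_map, Multiset.coe_eq_coe]
    refine List.Perm.of_eq (List.ext_get (by simp) fun k h1 h2 => by simp)
  refine ⟨z, hz, ?_⟩
  rw [hs.eq_prod_roots_of_monic hp, hz, Multiset.map_map]
  rfl

open Polynomial in
lemma tendsto_sum_roots_of_tendsto_eval {a b : ℕ} {p : ℝ → ℂ[X]} {c q : ℂ[X]}
    (hp : ∀ t, (p t).Monic) (hd : ∀ t, (p t).natDegree = a + b)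
    (hc : ∀ w, c.eval w = 0 → |w.re| = 1)
    (h1 : ∀ y : ℂ, Filter.Tendsto (fun t : ℝ => (p t).eval (t * y) / (t : ℂ) ^ (a + b))
      Filter.atTop (nhds (y ^ b * c.eval y)))
    (h2 : ∀ x : ℂ, Filter.Tendsto (fun t : ℝ => (p t).eval x / (t : ℂ) ^ a)
      Filter.atTop (nhds (c.eval 0 * q.eval x))) :
    Filter.Tendsto (fun t : ℝ => ((p t).roots.map fun μ => GFn |μ.re|).sum
      - (q.roots.map fun μ => GFn |μ.re|).sum - a * GFn t) Filter.atTop (nhds 0) := by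
  have hc0 : c.eval 0 ≠ 0 := fun h => by simpa using hc 0 h
  have hcne : c ≠ 0 := by rintro rfl; simp at hc0
  refine Filter.tendsto_of_subseq_tendsto fun t ht => ?_
  choose z hz hzp using fun k => exists_roots_eq_map (hp (t k)) (hd (t k))
  have hzsum : ∀ k, ((p (t k)).roots.map fun μ => GFn |μ.re|).sum
      = ∑ i, GFn |(z k i).re| := fun k => by
    rw [hz, Multiset.map_map]; rfl
  have hzeval : ∀ k x, (p (t k)).eval x = ∏ i, (x - z k i) := fun k x => by
    conv_lhs => rw [hzp k]
    simp [eval_prod]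
  have ht0 : ∀ᶠ k in Filter.atTop, (t k : ℂ) ≠ 0 := by
    filter_upwards [ht.eventually_gt_atTop 0] with k hk
    exact_mod_cast hk.ne'
  -- the rescaled roots converge along a subsequence
  obtain ⟨w, φ, hφ, hw, hwprod⟩ := exists_subseq_tendsto_of_tendsto_prod_sub
    (fun k i => z k i / t k) (X ^ b * c) fun y => by
      have h := (h1 y).comp ht
      simp only [eval_mul, eval_pow, eval_X]
      refine h.congr' ?_
      filter_upwards [ht0] with k hk
      simp only [Function.comp, hzeval]
      have : (t k : ℂ) ^ (a + b) = ∏ _i : Fin (a + b), (t k : ℂ) := by simp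
      rw [this, ← Finset.prod_div_distrib]
      refine Finset.prod_congr rfl fun i _ => ?_
      field_simp
  have hw' := tendsto_pi_nhds.1 hw
  have hsplit : (∏ i : {i // w i = 0}, (X - C (w i))) * (∏ i : {i // ¬ w i = 0}, (X - C (w i)))
      = X ^ b * c := by
    rw [Fintype.prod_subtype_mul_prod_subtype (fun i => w i = 0) fun i => X - C (w i), hwprod]
  have hS : (∏ i : {i // w i = 0}, (X - C (w i))) = X ^ Fintype.card {i // w i = 0} := by
    rw [Finset.prod_congr rfl fun (i : {i // w i = 0}) _ => by rw [i.2, C_0, sub_zero]]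
    simp
  rw [hS] at hsplit
  have hL0 : (∏ i : {i // ¬ w i = 0}, (X - C (w i))).eval 0 ≠ 0 := by
    rw [eval_prod, Finset.prod_ne_zero_iff]
    intro i _
    simpa using i.2
  have hcard : Fintype.card {i // w i = 0} = b := by
    have h := congrArg (rootMultiplicity 0) hsplit
    have hX : ∀ j, rootMultiplicity (0 : ℂ) (X ^ j) = j := fun j => by
      simpa using rootMultiplicity_X_sub_C_pow (0 : ℂ) j
    rwa [rootMultiplicity_mul (mul_ne_zero (pow_ne_zero _ X_ne_zero)
        (by intro h0; simp [h0] at hL0)),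
      rootMultiplicity_mul (mul_ne_zero (pow_ne_zero _ X_ne_zero) hcne), hX, hX,
      rootMultiplicity_eq_zero (by simpa [IsRoot] using hL0),
      rootMultiplicity_eq_zero (by simpa [IsRoot] using hc0)] at h
  have hLc : (∏ i : {i // ¬ w i = 0}, (X - C (w i))) = c := by
    rw [hcard] at hsplit
    exact mul_left_cancel₀ (pow_ne_zero _ X_ne_zero) hsplit
  have hcard' : Fintype.card {i // ¬ w i = 0} = a := by
    rw [Fintype.card_subtype_compl, hcard, Fintype.card_fin]
    omega
  have htφ := ht.comp hφ.tendsto_atTop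
  -- the small roots converge along a further subsequence
  obtain ⟨u, ψ, hψ, hu, huprod⟩ := exists_subseq_tendsto_of_tendsto_prod_sub
    (fun k (i : {i // w i = 0}) => z (φ k) i) q fun x => by
      have h := (h2 x).comp htφ
      have hL : Filter.Tendsto (fun k => ∏ i : {i // ¬ w i = 0}, (x / t (φ k) - z (φ k) i / t (φ k)))
          Filter.atTop (nhds (c.eval 0)) := by
        rw [← hLc, eval_prod]
        refine tendsto_finsetProd _ fun i _ => ?_
        rw [eval_sub, eval_X, eval_C]
        refine Filter.Tendsto.sub ?_ (hw' i)
        have hinv : Filter.Tendsto (fun k => ((t (φ k))⁻¹ : ℝ)) Filter.atTop (nhds 0) :=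
          tendsto_inv_atTop_zero.comp htφ
        have hinv' := ((Complex.continuous_ofReal.tendsto 0).comp hinv).const_mul x
        simpa [Function.comp_def, div_eq_mul_inv] using hinv'
      have h' := h.div hL hc0
      rw [mul_div_cancel_left₀ _ hc0] at h'
      refine h'.congr' ?_
      filter_upwards [hφ.tendsto_atTop.eventually ht0, hL.eventually_ne hc0] with k hk hk'
      rw [Pi.div_apply, div_eq_iff hk']
      simp only [Function.comp, hzeval]
      rw [div_eq_iff (pow_ne_zero _ hk),
        ← Fintype.prod_subtype_mul_prod_subtype (fun i => w i = 0), mul_assoc]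
      congr 1
      have : (t (φ k) : ℂ) ^ a = ∏ _i : {i // ¬ w i = 0}, (t (φ k) : ℂ) := by simp [hcard']
      rw [this, ← Finset.prod_mul_distrib]
      refine Finset.prod_congr rfl fun i _ => ?_
      field_simp
  have hu' := tendsto_pi_nhds.1 hu
  have hqsum : (q.roots.map fun μ => GFn |μ.re|).sum = ∑ i, GFn |(u i).re| := by
    have : q.roots = Finset.univ.val.map u := by
      rw [← huprod]
      have h := roots_multiset_prod_X_sub_C (Finset.univ.val.map u)
      rwa [Multiset.map_map] at h
    rw [this, Multiset.map_map]; rfl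
  refine ⟨φ ∘ ψ, ?_⟩
  have hsmall : Filter.Tendsto (fun k => ∑ i : {i // w i = 0}, GFn |(z (φ (ψ k)) i).re|)
      Filter.atTop (nhds (∑ i, GFn |(u i).re|)) := by
    refine tendsto_finsetSum _ fun i _ => ?_
    exact ((GFn_continuous.comp Complex.continuous_re.abs).tendsto (u i)).comp (hu' i)
  have hlarge : Filter.Tendsto (fun k => ∑ i : {i // ¬ w i = 0},
      (GFn |(z (φ (ψ k)) i).re| - GFn (t (φ (ψ k))))) Filter.atTop (nhds 0) := by
    have h0 : (0 : ℝ) = ∑ _i : {i // ¬ w i = 0}, (0 : ℝ) := by simp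
    rw [h0]
    refine tendsto_finsetSum _ fun i _ => ?_
    refine tendsto_GFn_sub_GFn (htφ.comp hψ.tendsto_atTop) ?_
    have hw1 : |(w i).re| = 1 := hc _ (by
      rw [← hLc, eval_prod]
      exact Finset.prod_eq_zero (Finset.mem_univ i) (by simp))
    have h := ((Complex.continuous_re.abs.tendsto (w i)).comp (hw' i)).comp hψ.tendsto_atTop
    rw [hw1] at h
    refine h.congr' ?_
    filter_upwards [(htφ.comp hψ.tendsto_atTop).eventually_gt_atTop 0] with k hk
    simp only [Function.comp] at hk ⊢
    rw [Complex.div_ofReal_re, abs_div, abs_of_pos hk]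
  have h := (hsmall.sub (tendsto_const_nhds (x := ∑ i, GFn |(u i).re|))).add hlarge
  rw [sub_self, add_zero] at h
  refine h.congr fun k => ?_
  simp only [Function.comp]
  rw [hzsum, hqsum, ← Fintype.sum_subtype_add_sum_subtype (fun i => w i = 0),
    Finset.sum_sub_distrib]
  simp only [Finset.sum_const, Finset.card_univ, hcard', nsmul_eq_mul]
  ring

lemma tendsto_eval_charpoly_fromBlocks_scaled {ι κ : Type*} [Fintype ι] [Fintype κ]
    [DecidableEq ι] [DecidableEq κ] (a j : Matrix ι ι ℂ) (k : Matrix ι κ ℂ) (k' : Matrix κ ι ℂ)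
    (b : Matrix κ κ ℂ) (y : ℂ) :
    Filter.Tendsto (fun t : ℝ => (Matrix.fromBlocks (a + (t : ℂ) • j) k k' b).charpoly.eval (t * y)
      / (t : ℂ) ^ (Fintype.card ι + Fintype.card κ))
      Filter.atTop (nhds (y ^ Fintype.card κ * j.charpoly.eval y)) := by
  let F : ℝ → ℂ := fun s => (Matrix.fromBlocks (Matrix.scalar ι y - (s : ℂ) • a - j)
    (-((s : ℂ) • k)) (-((s : ℂ) • k')) (Matrix.scalar κ y - (s : ℂ) • b)).det
  have hF : Continuous F := by
    refine Continuous.matrix_det (Continuous.matrix_fromBlocks ?_ ?_ ?_ ?_) <;> fun_prop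
  have hF0 : F 0 = y ^ Fintype.card κ * j.charpoly.eval y := by
    simp only [F, Complex.ofReal_zero, zero_smul, sub_zero, neg_zero,
      Matrix.det_fromBlocks_zero₁₂, Matrix.eval_charpoly]
    simp [mul_comm]
  rw [← hF0]
  refine ((hF.tendsto 0).comp tendsto_inv_atTop_zero).congr' ?_
  filter_upwards [Filter.eventually_gt_atTop 0] with t ht
  have ht' : (t : ℂ) ≠ 0 := by exact_mod_cast ht.ne'
  rw [eq_div_iff (pow_ne_zero _ ht'), mul_comm, ← Fintype.card_sum, Function.comp,
    ← Matrix.det_smul, Matrix.eval_charpoly]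
  congr 1
  ext (i | i) (l | l) <;> simp [Matrix.diagonal_apply] <;>
    (try split_ifs) <;> field_simp <;> ring

lemma tendsto_eval_charpoly_fromBlocks {ι κ : Type*} [Fintype ι] [Fintype κ]
    [DecidableEq ι] [DecidableEq κ] (a j : Matrix ι ι ℂ) (k : Matrix ι κ ℂ) (k' : Matrix κ ι ℂ)
    (b : Matrix κ κ ℂ) (x : ℂ) :
    Filter.Tendsto (fun t : ℝ => (Matrix.fromBlocks (a + (t : ℂ) • j) k k' b).charpoly.eval x
      / (t : ℂ) ^ Fintype.card ι)
      Filter.atTop (nhds (j.charpoly.eval 0 * b.charpoly.eval x)) := by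
  let F : ℝ → ℂ := fun s => (Matrix.fromBlocks ((s : ℂ) • (Matrix.scalar ι x - a) - j)
    (-((s : ℂ) • k)) (-k') (Matrix.scalar κ x - b)).det
  have hF : Continuous F := by
    refine Continuous.matrix_det (Continuous.matrix_fromBlocks ?_ ?_ ?_ ?_) <;> fun_prop
  have hF0 : F 0 = j.charpoly.eval 0 * b.charpoly.eval x := by
    simp only [F, Complex.ofReal_zero, zero_smul, neg_zero,
      Matrix.det_fromBlocks_zero₁₂, Matrix.eval_charpoly, map_zero]
  rw [← hF0]
  refine ((hF.tendsto 0).comp tendsto_inv_atTop_zero).congr' ?_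
  filter_upwards [Filter.eventually_gt_atTop 0] with t ht
  have ht' : (t : ℂ) ≠ 0 := by exact_mod_cast ht.ne'
  have hdet : (t : ℂ) ^ Fintype.card ι
      = (Matrix.fromBlocks ((t : ℂ) • (1 : Matrix ι ι ℂ)) 0 0 (1 : Matrix κ κ ℂ)).det := by
    rw [Matrix.det_fromBlocks_zero₁₂, Matrix.det_smul, Matrix.det_one, Matrix.det_one, mul_one,
      mul_one]
  rw [eq_div_iff (pow_ne_zero _ ht'), mul_comm, Function.comp, hdet,
    ← Matrix.det_mul, Matrix.eval_charpoly, Matrix.fromBlocks_multiply]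
  congr 1
  ext (i | i) (l | l) <;> simp [Matrix.diagonal_apply] <;> field_simp <;> ring

lemma abs_re_eq_one_of_eval_charpoly_eq_zero {ι : Type*} [Fintype ι] [DecidableEq ι]
    {j : Matrix ι ι ℂ} (hj : j * j = 1) {w : ℂ} (hw : j.charpoly.eval w = 0) : |w.re| = 1 := by
  have h : (Matrix.scalar ι w - j) * (Matrix.scalar ι w + j) = Matrix.scalar ι (w ^ 2 - 1) := by
    have hc : Matrix.scalar ι w * j = j * Matrix.scalar ι w :=
      Matrix.scalar_commute w (fun r => Commute.all w r) j
    rw [sub_mul, mul_add, mul_add, hj, ← hc, map_sub, map_pow, map_one, pow_two]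
    abel
  have hd := congrArg Matrix.det h
  rw [Matrix.det_mul, ← Matrix.eval_charpoly, hw, zero_mul] at hd
  have hw2 : w ^ 2 - 1 = 0 := by
    rw [Matrix.scalar_apply, Matrix.det_diagonal, Finset.prod_const] at hd
    by_contra h0
    exact pow_ne_zero _ h0 hd.symm
  rcases mul_self_eq_one_iff.mp ((pow_two w).symm.trans (sub_eq_zero.mp hw2)) with rfl | rfl <;> simp

lemma Jmat_mul_self (m : ℕ) : Jmat (2 * m) * Jmat (2 * m) = -1 := by
  ext i l
  rw [Matrix.mul_apply]
  obtain ⟨σ, hσ⟩ : ∃ σ : Fin (2 * m), (i : ℕ) % 2 = 0 ∧ (σ : ℕ) = i + 1 ∨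
      (i : ℕ) % 2 = 1 ∧ (σ : ℕ) + 1 = i := by
    rcases Nat.mod_two_eq_zero_or_one i with h | h
    · exact ⟨⟨i + 1, by omega⟩, Or.inl ⟨h, rfl⟩⟩
    · exact ⟨⟨i - 1, by omega⟩, Or.inr ⟨h, by simp only; omega⟩⟩
  rw [Finset.sum_eq_single σ]
  · simp only [Jmat, Matrix.neg_apply, Matrix.one_apply, Fin.ext_iff]
    split_ifs <;> first | omega | norm_num
  · intro k _ hk
    have : Jmat (2 * m) i k = 0 := by
      simp only [ne_eq, Fin.ext_iff] at hk
      simp only [Jmat]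
      split_ifs <;> first | rfl | omega
    rw [this, zero_mul]
  · simp

lemma Jmat_add (m n : ℕ) : Jmat (2 * m + 2 * n)
    = Matrix.reindex finSumFinEquiv finSumFinEquiv
      (Matrix.fromBlocks (Jmat (2 * m)) 0 0 (Jmat (2 * n))) := by
  rw [← Equiv.symm_apply_eq]
  have hoff : ∀ (i : Fin (2 * m)) (l : Fin (2 * n)),
      Jmat (2 * m + 2 * n) (Fin.castAdd _ i) (Fin.natAdd _ l) = 0 ∧
        Jmat (2 * m + 2 * n) (Fin.natAdd _ l) (Fin.castAdd _ i) = 0 := by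
    intro i l
    have hi := i.isLt
    simp only [Jmat, Fin.val_castAdd, Fin.val_natAdd]
    constructor <;> rw [if_neg (by omega), if_neg (by omega)]
  have hlow : ∀ i l : Fin (2 * n),
      Jmat (2 * m + 2 * n) (Fin.natAdd _ i) (Fin.natAdd _ l) = Jmat (2 * n) i l := by
    intro i l
    simp only [Jmat, Fin.val_natAdd]
    exact if_congr (by omega) rfl (if_congr (by omega) rfl rfl)
  ext (i | i) (l | l)
  · rfl
  · simpa using (hoff i l).1
  · simpa using (hoff l i).2
  · simpa using hlow i l

lemma assemble2_eq {a b : ℕ} (A : Matrix (Fin a) (Fin a) ℝ) (K : Matrix (Fin a) (Fin b) ℝ)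
    (B : Matrix (Fin b) (Fin b) ℝ) :
    assemble2 A K B = Matrix.reindex finSumFinEquiv finSumFinEquiv
      (Matrix.fromBlocks A K K.transpose B) := by
  rw [← Equiv.symm_apply_eq]
  ext (i | i) (l | l) <;> simp [assemble2]

lemma IA0B_eq (a b : ℕ) : IA0B (a + b) a = Matrix.reindex finSumFinEquiv finSumFinEquiv
    (Matrix.fromBlocks 1 0 0 0) := by
  rw [← Equiv.symm_apply_eq]
  ext (i | i) (l | l) <;> simp [IA0B, Matrix.diagonal_apply, Matrix.one_apply, Fin.ext_iff]
  omega

/-- The complex matrix `i·M` attached to a real matrix `M`. -/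
def iMat {ι κ : Type*} (M : Matrix ι κ ℝ) : Matrix ι κ ℂ := Complex.I • M.map Complex.ofReal

lemma iMat_Jmat_mul_self (m : ℕ) : iMat (Jmat (2 * m)) * iMat (Jmat (2 * m)) = 1 := by
  have h : (Jmat (2 * m)).map Complex.ofReal * (Jmat (2 * m)).map Complex.ofReal = -1 := by
    have h' := Matrix.map_mul (L := Jmat (2 * m)) (M := Jmat (2 * m)) (f := Complex.ofRealHom)
    rw [Jmat_mul_self] at h'
    refine h'.symm.trans ?_
    ext i l
    by_cases hil : i = l <;> simp [hil]
  rw [iMat, Matrix.smul_mul, Matrix.mul_smul, h, smul_smul, Complex.I_mul_I]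
  simp

lemma charpoly_iMat_Jmat_mul_assemble2 (m n : ℕ) (A : Matrix (Fin (2 * m)) (Fin (2 * m)) ℝ)
    (K : Matrix (Fin (2 * m)) (Fin (2 * n)) ℝ) (B : Matrix (Fin (2 * n)) (Fin (2 * n)) ℝ) (t : ℝ) :
    (iMat (Jmat (2 * m + 2 * n) *
      (assemble2 A K B + t • IA0B (2 * m + 2 * n) (2 * m)))).charpoly =
    (Matrix.fromBlocks (iMat (Jmat (2 * m) * A) + (t : ℂ) • iMat (Jmat (2 * m)))
      (iMat (Jmat (2 * m) * K)) (iMat (Jmat (2 * n) * K.transpose))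
      (iMat (Jmat (2 * n) * B))).charpoly := by
  rw [← Matrix.charpoly_reindex finSumFinEquiv]
  congr 1
  have hM : Jmat (2 * m + 2 * n) * (assemble2 A K B + t • IA0B (2 * m + 2 * n) (2 * m)) =
      Matrix.reindex finSumFinEquiv finSumFinEquiv
        (Matrix.fromBlocks (Jmat (2 * m) * A + t • Jmat (2 * m)) (Jmat (2 * m) * K)
          (Jmat (2 * n) * K.transpose) (Jmat (2 * n) * B)) := by
    rw [Jmat_add, assemble2_eq, IA0B_eq]
    simp only [Matrix.reindex_apply]
    have hadd : ∀ (e : Fin (2 * m + 2 * n) ≃ Fin (2 * m) ⊕ Fin (2 * n))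
        (X Y : Matrix (Fin (2 * m) ⊕ Fin (2 * n)) (Fin (2 * m) ⊕ Fin (2 * n)) ℝ),
        X.submatrix e e + t • Y.submatrix e e = (X + t • Y).submatrix e e := fun _ _ _ => rfl
    rw [hadd, Matrix.submatrix_mul_equiv]
    simp [Matrix.fromBlocks_smul, Matrix.fromBlocks_add, Matrix.fromBlocks_multiply, mul_add]
  rw [hM, ← Equiv.symm_apply_eq]
  ext (i | i) (l | l) <;> simp [iMat] <;> ring

/-- Scaling of conditional entropy in the infinite-time limit (Lemma 4.4). -/
theorem conditional_entropy_infinite_time (m n : ℕ) (hm : 1 ≤ m) (hn : 1 ≤ n)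
    (A : Matrix (Fin (2 * m)) (Fin (2 * m)) ℝ) (K : Matrix (Fin (2 * m)) (Fin (2 * n)) ℝ)
    (B : Matrix (Fin (2 * n)) (Fin (2 * n)) ℝ)
    (hQ : IsQCov (assemble2 A K B)) :
    Filter.Tendsto
      (fun t : ℝ => Ent (assemble2 A K B + t • IA0B (2 * m + 2 * n) (2 * m)) - Ent B
        - (m : ℝ) * gFn ((t - 1) / 2))
      Filter.atTop (nhds 0) := by
  have hent : ∀ {d : ℕ} (M : Matrix (Fin d) (Fin d) ℝ),
      Ent M = ((iMat (Jmat d * M)).charpoly.roots.map fun μ => GFn |μ.re|).sum / 2 :=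
    fun _ => rfl
  let p : ℝ → Polynomial ℂ := fun t =>
    (Matrix.fromBlocks (iMat (Jmat (2 * m) * A) + (t : ℂ) • iMat (Jmat (2 * m)))
      (iMat (Jmat (2 * m) * K)) (iMat (Jmat (2 * n) * K.transpose))
      (iMat (Jmat (2 * n) * B))).charpoly
  have h := tendsto_sum_roots_of_tendsto_eval (a := 2 * m) (b := 2 * n) (p := p)
    (c := (iMat (Jmat (2 * m))).charpoly) (q := (iMat (Jmat (2 * n) * B)).charpoly)
    (fun t => Matrix.charpoly_monic _)
    (fun t => by simp [p, Matrix.charpoly_natDegree_eq_dim])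
    (fun w hw => abs_re_eq_one_of_eval_charpoly_eq_zero (iMat_Jmat_mul_self m) hw)
    (fun y => by
      simpa only [Fintype.card_fin] using tendsto_eval_charpoly_fromBlocks_scaled
        (iMat (Jmat (2 * m) * A)) (iMat (Jmat (2 * m))) (iMat (Jmat (2 * m) * K))
        (iMat (Jmat (2 * n) * K.transpose)) (iMat (Jmat (2 * n) * B)) y)
    (fun x => by
      simpa only [Fintype.card_fin] using tendsto_eval_charpoly_fromBlocks
        (iMat (Jmat (2 * m) * A)) (iMat (Jmat (2 * m))) (iMat (Jmat (2 * m) * K))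
        (iMat (Jmat (2 * n) * K.transpose)) (iMat (Jmat (2 * n) * B)) x)
  have h' := h.div_const 2
  rw [zero_div] at h'
  refine h'.congr fun t => ?_
  rw [hent, hent, charpoly_iMat_Jmat_mul_assemble2]
  simp only [p, GFn]
  push_cast
  ring

end
end

section
/- Conditional Fisher information inequality for Gaussian states in explicit form (Eq. (6.10) evaluated on Gaussian states): Let n, L₁, L₂ ≥ 1 and λ ∈ [0,1]. Let M₁ (size 2(n+L₁)) and M₂ (size 2(n+L₂)) be valid quantum covariance matrices, written in block form M₁ = [[A₁,K₁],[K₁ᵀ,B₁]], M₂ = [[A₂,K₂],[K₂ᵀ,B₂]] with system blocks A₁, A₂ of size 2n, and let M_out (size 2(n+L₁+L₂)) be the matrix with Y-block λ·A₁+(1−λ)·A₂, Y–E₁ block √λ·K₁, Y–E₂ block √(1−λ)·K₂, E₁-block B₁, E₂-block B₂ and E₁–E₂ block 0. Suppose S₁·M₁·S₁ᵀ = D(γ¹), S₂·M₂·S₂ᵀ = D(γ²) and S₃·M_out·S₃ᵀ = D(γ³) are symplectic diagonalizations whose symplectic eigenvalues are all strictly greater than 1. Define, for a symplectic diagonalization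 (S,γ) of such a matrix whose first 2n coordinates are the conditioned system's modes, 𝒥(S,γ) := Σ_j β(γ_j)·Σ_{k=1}^{2n}(S_{2j−1,k}² + S_{2j,k}²). Then 𝒥(S₃,γ³) ≤ λ·𝒥(S₁,γ¹) + (1−λ)·𝒥(S₂,γ²). -/
open scoped Classical ComplexOrder

noncomputable section

open Matrix

lemma sum_fin_eq_sum_pairs {d N : ℕ} (hd : d = 2 * N) (f : Fin d → ℝ) :
    ∑ i, f i = ∑ j : Fin N, (f ⟨2 * j, by omega⟩ + f ⟨2 * j + 1, by omega⟩) := by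
  subst hd
  induction N with
  | zero => simp
  | succ N ih =>
    rw [Fin.sum_univ_castSucc (n := N)]
    have := Fin.sum_univ_castSucc (n := 2 * N + 1) f
    rw [Fin.sum_univ_castSucc (n := 2 * N)] at this
    refine this.trans ?_
    have h := ih fun i => f ⟨i, by omega⟩
    rw [add_assoc]
    exact congrArg₂ (· + ·) h rfl

lemma Jmat_mulVec_even {d N : ℕ} (hd : d = 2 * N) (q : Fin d → ℝ) (j : Fin N) :
    (Jmat d *ᵥ q) ⟨2 * j, by omega⟩ = q ⟨2 * j + 1, by omega⟩ := by
  rw [Matrix.mulVec, dotProduct, Finset.sum_eq_single ⟨2 * j + 1, by omega⟩]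
  · simp [Jmat]
  · intro b _ hb
    have : (b : ℕ) ≠ 2 * j + 1 := fun h => hb (Fin.ext h)
    simp only [Jmat]
    rw [if_neg (by omega), if_neg (by omega), zero_mul]
  · simp

lemma Jmat_mulVec_odd {d N : ℕ} (hd : d = 2 * N) (q : Fin d → ℝ) (j : Fin N) :
    (Jmat d *ᵥ q) ⟨2 * j + 1, by omega⟩ = -q ⟨2 * j, by omega⟩ := by
  rw [Matrix.mulVec, dotProduct, Finset.sum_eq_single ⟨2 * j, by omega⟩]
  · simp [Jmat]
  · intro b _ hb
    have : (b : ℕ) ≠ 2 * j := fun h => hb (Fin.ext h)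
    simp only [Jmat]
    rw [if_neg (by omega), if_neg (by omega), zero_mul]
  · simp

/-- The real form of `2 Re ⟨u, c e_k⟩ - ⟨u, (M + i t J) u⟩` at `u = x + i y`. Its maximum over
`u` is `c ^ 2` times the `k`-th diagonal entry of `(M + i t J)⁻¹`. -/
def resolventFunctional {d : ℕ} (M : Matrix (Fin d) (Fin d) ℝ) (t c : ℝ) (k : Fin d)
    (x y : Fin d → ℝ) : ℝ :=
  2 * (c * x k) - (x ⬝ᵥ M *ᵥ x + y ⬝ᵥ M *ᵥ y + 2 * t * (x ⬝ᵥ Jmat d *ᵥ y))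

lemma transpose_mulVec_dotProduct {d : ℕ} (S M : Matrix (Fin d) (Fin d) ℝ) (p q : Fin d → ℝ) :
    (Sᵀ *ᵥ p) ⬝ᵥ M *ᵥ (Sᵀ *ᵥ q) = p ⬝ᵥ (S * M * Sᵀ) *ᵥ q := by
  rw [← Matrix.mulVec_mulVec, ← Matrix.mulVec_mulVec, Matrix.dotProduct_mulVec p S,
    Matrix.mulVec_transpose]

lemma resolventFunctional_transpose_mulVec {d N : ℕ} (hd : d = 2 * N)
    {S M : Matrix (Fin d) (Fin d) ℝ} {γ : ℕ → ℝ} (hS : IsSymplectic S)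
    (hM : S * M * Sᵀ = Dmat d γ) (t c : ℝ) (k : Fin d) (p q : Fin d → ℝ) :
    resolventFunctional M t c k (Sᵀ *ᵥ p) (Sᵀ *ᵥ q) = ∑ j : Fin N,
      (2 * (c * S ⟨2 * j, by omega⟩ k * p ⟨2 * j, by omega⟩ +
          c * S ⟨2 * j + 1, by omega⟩ k * p ⟨2 * j + 1, by omega⟩) -
        (γ j * (p ⟨2 * j, by omega⟩ ^ 2 + p ⟨2 * j + 1, by omega⟩ ^ 2) +
          γ j * (q ⟨2 * j, by omega⟩ ^ 2 + q ⟨2 * j + 1, by omega⟩ ^ 2) +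
          2 * t * (p ⟨2 * j, by omega⟩ * q ⟨2 * j + 1, by omega⟩ -
            p ⟨2 * j + 1, by omega⟩ * q ⟨2 * j, by omega⟩))) := by
  have hD (p : Fin d → ℝ) : p ⬝ᵥ Dmat d γ *ᵥ p =
      ∑ j : Fin N, γ j * (p ⟨2 * j, by omega⟩ ^ 2 + p ⟨2 * j + 1, by omega⟩ ^ 2) := by
    rw [dotProduct, sum_fin_eq_sum_pairs hd]
    refine Finset.sum_congr rfl fun j _ => ?_
    have h : (2 * (j : ℕ) + 1) / 2 = j := by omega
    simp only [Dmat, Matrix.mulVec_diagonal, h, Nat.mul_div_cancel_left _ two_pos]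
    ring
  have hJ : p ⬝ᵥ Jmat d *ᵥ q = ∑ j : Fin N,
      (p ⟨2 * j, by omega⟩ * q ⟨2 * j + 1, by omega⟩ -
        p ⟨2 * j + 1, by omega⟩ * q ⟨2 * j, by omega⟩) := by
    rw [dotProduct, sum_fin_eq_sum_pairs hd]
    refine Finset.sum_congr rfl fun j _ => ?_
    rw [Jmat_mulVec_even hd, Jmat_mulVec_odd hd]
    ring
  have hk : (Sᵀ *ᵥ p) k = ∑ j : Fin N, (S ⟨2 * j, by omega⟩ k * p ⟨2 * j, by omega⟩ +
      S ⟨2 * j + 1, by omega⟩ k * p ⟨2 * j + 1, by omega⟩) := by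
    rw [Matrix.mulVec, dotProduct, sum_fin_eq_sum_pairs hd]
    rfl
  rw [resolventFunctional, transpose_mulVec_dotProduct, transpose_mulVec_dotProduct,
    transpose_mulVec_dotProduct, hM, show S * Jmat d * Sᵀ = Jmat d from hS, hD, hD, hJ, hk]
  simp only [Finset.mul_sum, ← Finset.sum_add_distrib, ← Finset.sum_sub_distrib, mul_add,
    mul_assoc]

lemma single_mode_bound {g t : ℝ} (hg : 1 < g) (ht : t ^ 2 ≤ 1) (a b p r q s : ℝ) :
    2 * (a * p + b * r) - (g * (p ^ 2 + r ^ 2) + g * (q ^ 2 + s ^ 2) + 2 * t * (p * s - r * q)) ≤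
      g / (g ^ 2 - t ^ 2) * (a ^ 2 + b ^ 2) := by
  have hg0 : 0 < g := by linarith
  have hδ : 0 < g ^ 2 - t ^ 2 := by nlinarith
  have key : g / (g ^ 2 - t ^ 2) * (a ^ 2 + b ^ 2) -
      (2 * (a * p + b * r) -
        (g * (p ^ 2 + r ^ 2) + g * (q ^ 2 + s ^ 2) + 2 * t * (p * s - r * q))) =
      (g ^ 2 - t ^ 2) / g * ((p - a * g / (g ^ 2 - t ^ 2)) ^ 2 +
        (r - b * g / (g ^ 2 - t ^ 2)) ^ 2) +
      g * ((s + t * p / g) ^ 2 + (q - t * r / g) ^ 2) := by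
    field_simp
    ring
  have : 0 ≤ (g ^ 2 - t ^ 2) / g * ((p - a * g / (g ^ 2 - t ^ 2)) ^ 2 +
        (r - b * g / (g ^ 2 - t ^ 2)) ^ 2) +
      g * ((s + t * p / g) ^ 2 + (q - t * r / g) ^ 2) := by positivity
  linarith

lemma resolventFunctional_le {d N : ℕ} (hd : d = 2 * N) {S M : Matrix (Fin d) (Fin d) ℝ}
    {γ : ℕ → ℝ} (hS : IsSymplectic S) (hM : S * M * Sᵀ = Dmat d γ) (hγ : ∀ j < N, 1 < γ j)
    {t : ℝ} (ht : t ^ 2 ≤ 1) (c : ℝ) (k : Fin d) (x y : Fin d → ℝ) :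
    resolventFunctional M t c k x y ≤ c ^ 2 * ∑ j : Fin N, γ j / (γ j ^ 2 - t ^ 2) *
      (S ⟨2 * j, by omega⟩ k ^ 2 + S ⟨2 * j + 1, by omega⟩ k ^ 2) := by
  have hdet : IsUnit Sᵀ.det := by
    rw [isUnit_iff_ne_zero]
    intro h
    have hDdet := congrArg Matrix.det hM
    rw [Matrix.det_mul, h, mul_zero, Dmat, Matrix.det_diagonal, eq_comm,
      Finset.prod_eq_zero_iff] at hDdet
    obtain ⟨i, -, hi⟩ := hDdet
    have hlt : (i : ℕ) / 2 < N := by have := i.isLt; omega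
    linarith [hγ _ hlt]
  have hinv (v : Fin d → ℝ) : Sᵀ *ᵥ (Sᵀ⁻¹ *ᵥ v) = v := by
    rw [Matrix.mulVec_mulVec, Matrix.mul_nonsing_inv _ hdet, Matrix.one_mulVec]
  rw [← hinv x, ← hinv y, resolventFunctional_transpose_mulVec hd hS hM, Finset.mul_sum]
  refine Finset.sum_le_sum fun j _ =>
    (single_mode_bound (hγ j j.isLt) ht ..).trans_eq ?_
  ring

lemma exists_resolventFunctional_eq {d N : ℕ} (hd : d = 2 * N) {S M : Matrix (Fin d) (Fin d) ℝ}
    {γ : ℕ → ℝ} (hS : IsSymplectic S) (hM : S * M * Sᵀ = Dmat d γ) (hγ : ∀ j < N, 1 < γ j)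
    {t : ℝ} (ht : t ^ 2 ≤ 1) (k : Fin d) :
    ∃ x y, resolventFunctional M t 1 k x y = ∑ j : Fin N, γ j / (γ j ^ 2 - t ^ 2) *
      (S ⟨2 * j, by omega⟩ k ^ 2 + S ⟨2 * j + 1, by omega⟩ k ^ 2) := by
  let p : Fin d → ℝ := fun i => γ (i / 2) / (γ (i / 2) ^ 2 - t ^ 2) * S i k
  let q : Fin d → ℝ := fun i => -(t / (γ (i / 2) ^ 2 - t ^ 2) *
    -(Jmat d *ᵥ fun l => S l k) i)
  refine ⟨Sᵀ *ᵥ p, Sᵀ *ᵥ q, ?_⟩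
  rw [resolventFunctional_transpose_mulVec hd hS hM]
  refine Finset.sum_congr rfl fun j _ => ?_
  have h : (2 * (j : ℕ) + 1) / 2 = j := by omega
  have hg := hγ j j.isLt
  have hδ : γ j ^ 2 - t ^ 2 ≠ 0 := by nlinarith
  simp only [p, q, Jmat_mulVec_even hd, Jmat_mulVec_odd hd, h, Nat.mul_div_cancel_left _ two_pos]
  field_simp
  ring

lemma dotProduct_assemble2_mulVec {a b : ℕ} (A : Matrix (Fin a) (Fin a) ℝ)
    (K : Matrix (Fin a) (Fin b) ℝ) (B : Matrix (Fin b) (Fin b) ℝ)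
    (x y : Fin a → ℝ) (u v : Fin b → ℝ) :
    Fin.append x u ⬝ᵥ assemble2 A K B *ᵥ Fin.append y v =
      x ⬝ᵥ A *ᵥ y + x ⬝ᵥ K *ᵥ v + u ⬝ᵥ Kᵀ *ᵥ y + u ⬝ᵥ B *ᵥ v := by
  simp [dotProduct, Matrix.mulVec, Fin.sum_univ_add, assemble2, mul_add, Finset.sum_add_distrib]
  ring

lemma dotProduct_assemble3_mulVec {a b c : ℕ} (Y : Matrix (Fin a) (Fin a) ℝ)
    (K₁ : Matrix (Fin a) (Fin b) ℝ) (K₂ : Matrix (Fin a) (Fin c) ℝ)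
    (B₁ : Matrix (Fin b) (Fin b) ℝ) (B₂ : Matrix (Fin c) (Fin c) ℝ)
    (x y : Fin a → ℝ) (u v : Fin b → ℝ) (w z : Fin c → ℝ) :
    Fin.append (Fin.append x u) w ⬝ᵥ assemble3 Y K₁ K₂ B₁ B₂ *ᵥ Fin.append (Fin.append y v) z =
      x ⬝ᵥ Y *ᵥ y + x ⬝ᵥ K₁ *ᵥ v + x ⬝ᵥ K₂ *ᵥ z + u ⬝ᵥ K₁ᵀ *ᵥ y + w ⬝ᵥ K₂ᵀ *ᵥ y +
        u ⬝ᵥ B₁ *ᵥ v + w ⬝ᵥ B₂ *ᵥ z := by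
  have h (i : Fin c) : ¬ a + b + (i : ℕ) < a := by omega
  simp [dotProduct, Matrix.mulVec, Fin.sum_univ_add, assemble3, mul_add, Finset.sum_add_distrib,
    h, Nat.sub_sub]
  ring

/-- The quadratic form of a beamsplitter output splits over the two inputs. -/
lemma dotProduct_beamsplitter_mulVec {a b c : ℕ} {lam : ℝ} (h0 : 0 ≤ lam) (h1 : lam ≤ 1)
    (A₁ A₂ : Matrix (Fin a) (Fin a) ℝ)
    (K₁ : Matrix (Fin a) (Fin b) ℝ) (K₂ : Matrix (Fin a) (Fin c) ℝ)
    (B₁ : Matrix (Fin b) (Fin b) ℝ) (B₂ : Matrix (Fin c) (Fin c) ℝ)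
    (x y : Fin a → ℝ) (u v : Fin b → ℝ) (w z : Fin c → ℝ) :
    Fin.append (Fin.append x u) w ⬝ᵥ assemble3 (lam • A₁ + (1 - lam) • A₂)
        (Real.sqrt lam • K₁) (Real.sqrt (1 - lam) • K₂) B₁ B₂ *ᵥ
          Fin.append (Fin.append y v) z =
      Fin.append (Real.sqrt lam • x) u ⬝ᵥ assemble2 A₁ K₁ B₁ *ᵥ
          Fin.append (Real.sqrt lam • y) v +
        Fin.append (Real.sqrt (1 - lam) • x) w ⬝ᵥ assemble2 A₂ K₂ B₂ *ᵥ
          Fin.append (Real.sqrt (1 - lam) • y) z := by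
  rw [dotProduct_assemble3_mulVec, dotProduct_assemble2_mulVec, dotProduct_assemble2_mulVec]
  simp only [Matrix.add_mulVec, Matrix.smul_mulVec, Matrix.mulVec_smul, dotProduct_add,
    dotProduct_smul, smul_dotProduct, smul_eq_mul, Matrix.transpose_smul, ← mul_assoc,
    Real.mul_self_sqrt h0, Real.mul_self_sqrt (sub_nonneg.2 h1)]
  ring

lemma Jmat_eq_assemble2 (n L : ℕ) :
    Jmat (2 * n + 2 * L) = assemble2 (Jmat (2 * n)) 0 (Jmat (2 * L)) := by
  ext i j
  simp only [Jmat, assemble2, Matrix.zero_apply]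
  split_ifs <;> first | rfl | omega

lemma Jmat_eq_assemble3 (n L₁ L₂ : ℕ) :
    Jmat (2 * n + 2 * L₁ + 2 * L₂) =
      assemble3 (Jmat (2 * n)) 0 0 (Jmat (2 * L₁)) (Jmat (2 * L₂)) := by
  ext i j
  simp only [Jmat, assemble3, Matrix.zero_apply]
  split_ifs <;> first | rfl | omega

lemma resolventFunctional_beamsplitter {n L₁ L₂ : ℕ} {lam : ℝ} (h0 : 0 ≤ lam) (h1 : lam ≤ 1)
    (A₁ A₂ : Matrix (Fin (2 * n)) (Fin (2 * n)) ℝ)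
    (K₁ : Matrix (Fin (2 * n)) (Fin (2 * L₁)) ℝ) (K₂ : Matrix (Fin (2 * n)) (Fin (2 * L₂)) ℝ)
    (B₁ : Matrix (Fin (2 * L₁)) (Fin (2 * L₁)) ℝ) (B₂ : Matrix (Fin (2 * L₂)) (Fin (2 * L₂)) ℝ)
    (t : ℝ) (k : Fin (2 * n)) (x y : Fin (2 * n) → ℝ) (u v : Fin (2 * L₁) → ℝ)
    (w z : Fin (2 * L₂) → ℝ) :
    resolventFunctional (assemble3 (lam • A₁ + (1 - lam) • A₂)
        (Real.sqrt lam • K₁) (Real.sqrt (1 - lam) • K₂) B₁ B₂) t 1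
        (Fin.castAdd _ (Fin.castAdd _ k))
        (Fin.append (Fin.append x u) w) (Fin.append (Fin.append y v) z) =
      resolventFunctional (assemble2 A₁ K₁ B₁) t (Real.sqrt lam) (Fin.castAdd _ k)
          (Fin.append (Real.sqrt lam • x) u) (Fin.append (Real.sqrt lam • y) v) +
        resolventFunctional (assemble2 A₂ K₂ B₂) t (Real.sqrt (1 - lam)) (Fin.castAdd _ k)
          (Fin.append (Real.sqrt (1 - lam) • x) w) (Fin.append (Real.sqrt (1 - lam) • y) z) := by
  have hJ : Jmat (2 * n + 2 * L₁ + 2 * L₂) = assemble3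
      (lam • Jmat (2 * n) + (1 - lam) • Jmat (2 * n)) (Real.sqrt lam • 0)
      (Real.sqrt (1 - lam) • 0) (Jmat (2 * L₁)) (Jmat (2 * L₂)) := by
    rw [Jmat_eq_assemble3, ← add_smul, add_sub_cancel, one_smul, smul_zero, smul_zero]
  simp only [resolventFunctional]
  rw [hJ]
  simp only [dotProduct_beamsplitter_mulVec h0 h1, ← Jmat_eq_assemble2, Fin.append_left,
    Pi.smul_apply, smul_eq_mul, ← mul_assoc (Real.sqrt _), Real.mul_self_sqrt h0,
    Real.mul_self_sqrt (sub_nonneg.2 h1)]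
  ring

lemma continuousOn_div_sq_sub_sq {g : ℝ} (hg : 1 < g) :
    ContinuousOn (fun t : ℝ => g / (g ^ 2 - t ^ 2)) (Set.uIcc (-1) 1) := by
  refine ContinuousOn.div (by fun_prop) (by fun_prop) fun t ht => ?_
  rw [Set.uIcc_of_le (by norm_num)] at ht
  nlinarith [ht.1, ht.2]

/-- `β(g) = log ((g + 1) / (g - 1))` as an average of resolvents. -/
lemma integral_div_sq_sub_sq {g : ℝ} (hg : 1 < g) :
    ∫ t in (-1 : ℝ)..1, g / (g ^ 2 - t ^ 2) = betaFn g := by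
  have hderiv : ∀ t ∈ Set.uIcc (-1 : ℝ) 1,
      HasDerivAt (fun t => (Real.log (g + t) - Real.log (g - t)) / 2) (g / (g ^ 2 - t ^ 2)) t := by
    intro t ht
    rw [Set.uIcc_of_le (by norm_num)] at ht
    have hp : g + t ≠ 0 := by linarith [ht.1]
    have hm : g - t ≠ 0 := by linarith [ht.2]
    have hsq : g ^ 2 - t ^ 2 ≠ 0 := by
      rw [sq_sub_sq]
      exact mul_ne_zero hp hm
    refine ((((hasDerivAt_id t).const_add g).log hp).sub
      (((hasDerivAt_id t).const_sub g).log hm) |>.div_const 2).congr_deriv ?_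
    simp only [id]
    field_simp
    ring
  rw [intervalIntegral.integral_eq_sub_of_hasDerivAt hderiv
    (continuousOn_div_sq_sub_sq hg).intervalIntegrable, betaFn,
    Real.log_div (by linarith) (by linarith), sub_neg_eq_add, ← sub_eq_add_neg]
  ring

/-- The diagonal entries of `(M + i t J)⁻¹` in terms of a symplectic diagonalization, summed over
the first `m` coordinates. -/
def resolventTrace {d N : ℕ} (hd : d = 2 * N) (m : ℕ) (hm : m ≤ d) (S : Matrix (Fin d) (Fin d) ℝ)
    (γ : ℕ → ℝ) (t : ℝ) : ℝ :=
  ∑ k : Fin m, ∑ j : Fin N, γ j / (γ j ^ 2 - t ^ 2) *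
    (S ⟨2 * j, by omega⟩ ⟨k, by omega⟩ ^ 2 + S ⟨2 * j + 1, by omega⟩ ⟨k, by omega⟩ ^ 2)

lemma continuousOn_resolventTrace {d N : ℕ} (hd : d = 2 * N) (m : ℕ) (hm : m ≤ d)
    (S : Matrix (Fin d) (Fin d) ℝ) {γ : ℕ → ℝ} (hγ : ∀ j < N, 1 < γ j) :
    ContinuousOn (resolventTrace hd m hm S γ) (Set.uIcc (-1) 1) :=
  continuousOn_finsetSum _ fun _ _ => continuousOn_finsetSum _ fun j _ =>
    (continuousOn_div_sq_sub_sq (hγ j j.isLt)).mul continuousOn_const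

lemma integral_resolventTrace {d N : ℕ} (hd : d = 2 * N) (m : ℕ) (hm : m ≤ d)
    (S : Matrix (Fin d) (Fin d) ℝ) {γ : ℕ → ℝ} (hγ : ∀ j < N, 1 < γ j) :
    ∫ t in (-1 : ℝ)..1, resolventTrace hd m hm S γ t =
      ∑ j : Fin N, betaFn (γ j) * ∑ k : Fin m,
        (S ⟨2 * j, by omega⟩ ⟨k, by omega⟩ ^ 2 +
          S ⟨2 * j + 1, by omega⟩ ⟨k, by omega⟩ ^ 2) := by
  have hc (k : Fin m) (j : Fin N) : ContinuousOn (fun t : ℝ => γ j / (γ j ^ 2 - t ^ 2) *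
      (S ⟨2 * j, by omega⟩ ⟨k, by omega⟩ ^ 2 + S ⟨2 * j + 1, by omega⟩ ⟨k, by omega⟩ ^ 2))
      (Set.uIcc (-1) 1) :=
    (continuousOn_div_sq_sub_sq (hγ j j.isLt)).mul continuousOn_const
  simp only [resolventTrace]
  rw [intervalIntegral.integral_finsetSum fun k _ =>
    (continuousOn_finsetSum _ fun j _ => hc k j).intervalIntegrable]
  simp only [Finset.mul_sum]
  rw [Finset.sum_comm]
  refine Finset.sum_congr rfl fun k _ => ?_
  rw [intervalIntegral.integral_finsetSum fun j _ => (hc k j).intervalIntegrable]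
  refine Finset.sum_congr rfl fun j _ => ?_
  rw [intervalIntegral.integral_mul_const, integral_div_sq_sub_sq (hγ j j.isLt)]

/-- Conditional Fisher information inequality for Gaussian states
in explicit form. -/
theorem conditional_fisher_inequality (n L₁ L₂ : ℕ) (hn : 1 ≤ n) (hL₁ : 1 ≤ L₁) (hL₂ : 1 ≤ L₂)
    (lam : ℝ) (hlam0 : 0 ≤ lam) (hlam1 : lam ≤ 1)
    (A₁ : Matrix (Fin (2 * n)) (Fin (2 * n)) ℝ) (K₁ : Matrix (Fin (2 * n)) (Fin (2 * L₁)) ℝ)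
    (B₁ : Matrix (Fin (2 * L₁)) (Fin (2 * L₁)) ℝ)
    (A₂ : Matrix (Fin (2 * n)) (Fin (2 * n)) ℝ) (K₂ : Matrix (Fin (2 * n)) (Fin (2 * L₂)) ℝ)
    (B₂ : Matrix (Fin (2 * L₂)) (Fin (2 * L₂)) ℝ)
    (hM₁ : IsQCov (assemble2 A₁ K₁ B₁)) (hM₂ : IsQCov (assemble2 A₂ K₂ B₂))
    (S₁ : Matrix (Fin (2 * n + 2 * L₁)) (Fin (2 * n + 2 * L₁)) ℝ)
    (S₂ : Matrix (Fin (2 * n + 2 * L₂)) (Fin (2 * n + 2 * L₂)) ℝ)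
    (S₃ : Matrix (Fin (2 * n + 2 * L₁ + 2 * L₂)) (Fin (2 * n + 2 * L₁ + 2 * L₂)) ℝ)
    (γ₁ γ₂ γ₃ : ℕ → ℝ)
    (hS₁ : IsSymplectic S₁) (hS₂ : IsSymplectic S₂) (hS₃ : IsSymplectic S₃)
    (hd₁ : S₁ * assemble2 A₁ K₁ B₁ * S₁.transpose = Dmat (2 * n + 2 * L₁) γ₁)
    (hd₂ : S₂ * assemble2 A₂ K₂ B₂ * S₂.transpose = Dmat (2 * n + 2 * L₂) γ₂)
    (hd₃ : S₃ * assemble3 (lam • A₁ + (1 - lam) • A₂)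
        (Real.sqrt lam • K₁) (Real.sqrt (1 - lam) • K₂) B₁ B₂ * S₃.transpose =
        Dmat (2 * n + 2 * L₁ + 2 * L₂) γ₃)
    (hγ₁ : ∀ j < n + L₁, 1 < γ₁ j) (hγ₂ : ∀ j < n + L₂, 1 < γ₂ j)
    (hγ₃ : ∀ j < n + L₁ + L₂, 1 < γ₃ j) :
    (∑ j : Fin (n + L₁ + L₂), betaFn (γ₃ j) * ∑ k : Fin (2 * n),
        (S₃ ⟨2 * j, by have := j.isLt; omega⟩ ⟨k, by have := k.isLt; omega⟩ ^ 2 +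
         S₃ ⟨2 * j + 1, by have := j.isLt; omega⟩ ⟨k, by have := k.isLt; omega⟩ ^ 2)) ≤
      lam * (∑ j : Fin (n + L₁), betaFn (γ₁ j) * ∑ k : Fin (2 * n),
        (S₁ ⟨2 * j, by have := j.isLt; omega⟩ ⟨k, by have := k.isLt; omega⟩ ^ 2 +
         S₁ ⟨2 * j + 1, by have := j.isLt; omega⟩ ⟨k, by have := k.isLt; omega⟩ ^ 2)) +
      (1 - lam) * (∑ j : Fin (n + L₂), betaFn (γ₂ j) * ∑ k : Fin (2 * n),
        (S₂ ⟨2 * j, by have := j.isLt; omega⟩ ⟨k, by have := k.isLt; omega⟩ ^ 2 +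
         S₂ ⟨2 * j + 1, by have := j.isLt; omega⟩ ⟨k, by have := k.isLt; omega⟩ ^ 2)) := by
  have e₁ : 2 * n + 2 * L₁ = 2 * (n + L₁) := by ring
  have e₂ : 2 * n + 2 * L₂ = 2 * (n + L₂) := by ring
  have e₃ : 2 * n + 2 * L₁ + 2 * L₂ = 2 * (n + L₁ + L₂) := by ring
  have l₁ : 2 * n ≤ 2 * n + 2 * L₁ := by omega
  have l₂ : 2 * n ≤ 2 * n + 2 * L₂ := by omega
  have l₃ : 2 * n ≤ 2 * n + 2 * L₁ + 2 * L₂ := by omega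
  have hpt : ∀ t ∈ Set.Icc (-1 : ℝ) 1, resolventTrace e₃ (2 * n) l₃ S₃ γ₃ t ≤
      lam * resolventTrace e₁ (2 * n) l₁ S₁ γ₁ t +
        (1 - lam) * resolventTrace e₂ (2 * n) l₂ S₂ γ₂ t := by
    intro t ht
    have ht2 : t ^ 2 ≤ 1 := by nlinarith [ht.1, ht.2]
    rw [resolventTrace, resolventTrace, resolventTrace, Finset.mul_sum, Finset.mul_sum,
      ← Finset.sum_add_distrib]
    refine Finset.sum_le_sum fun k _ => ?_
    obtain ⟨x, y, hxy⟩ := exists_resolventFunctional_eq e₃ hS₃ hd₃ hγ₃ ht2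
      (Fin.castAdd _ (Fin.castAdd _ k))
    rw [← Fin.append_castAdd_natAdd (f := x), ← Fin.append_castAdd_natAdd (f := y),
      ← Fin.append_castAdd_natAdd (f := fun i => x (Fin.castAdd _ i)),
      ← Fin.append_castAdd_natAdd (f := fun i => y (Fin.castAdd _ i)),
      resolventFunctional_beamsplitter hlam0 hlam1] at hxy
    have h₁ := resolventFunctional_le e₁ hS₁ hd₁ hγ₁ ht2 (Real.sqrt lam) (Fin.castAdd _ k)
    have h₂ := resolventFunctional_le e₂ hS₂ hd₂ hγ₂ ht2 (Real.sqrt (1 - lam)) (Fin.castAdd _ k)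
    rw [Real.sq_sqrt hlam0] at h₁
    rw [Real.sq_sqrt (sub_nonneg.2 hlam1)] at h₂
    exact hxy.symm.le.trans (add_le_add (h₁ _ _) (h₂ _ _))
  have i₁ := ((continuousOn_resolventTrace e₁ _ l₁ S₁ hγ₁).intervalIntegrable
    (μ := MeasureTheory.volume)).const_mul lam
  have i₂ := ((continuousOn_resolventTrace e₂ _ l₂ S₂ hγ₂).intervalIntegrable
    (μ := MeasureTheory.volume)).const_mul (1 - lam)
  have h := intervalIntegral.integral_mono_on (by norm_num)
    (continuousOn_resolventTrace e₃ _ l₃ S₃ hγ₃).intervalIntegrable (i₁.add i₂) hpt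
  rwa [intervalIntegral.integral_add i₁ i₂, intervalIntegral.integral_const_mul,
    intervalIntegral.integral_const_mul, integral_resolventTrace _ _ _ _ hγ₁,
    integral_resolventTrace _ _ _ _ hγ₂, integral_resolventTrace _ _ _ _ hγ₃] at h

end
end
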